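/- arXiv:2009.09479 — 2 statements merged into one kernel-verified Lean document; each statement's English description precedes it below -/
import Mathlib

section
/- Let V be a level zero irreducible highest weight module for the twisted full toroidal Lie algebra τ̃ having finite-dimensional weight spaces with respect to h̃, on whose highest weight space V₊ the subalgebra 𝔥_{0̄} does not act trivially; fix Λ ∈ P(V) with Λ|_{𝔥_{0̄}} ≠ 0 satisfying h·w = Λ(h)w for all h ∈ 𝔥_{0̄} and w ∈ V₊, and h₀ ∈ 𝔥_{0̄} with Λ(h₀) ≠ 0. Write V₊ = ⊕_{m∈ℤⁿ} V₊(m), where V₊(m) = {v ∈ V₊ : dᵢ·v = (Λ(dᵢ)+mᵢ)v for all i}. Then: (1) dim V₊(k) = dim V₊(k+r) for all k ∈ ℤⁿ and r ∈ Γ; in particular dim V₊(r) = dim V₊(s) = N ∈ ℕ for all r, s ∈ Γ; (2) if w ∈ V₊ is nonzero and (t^r Kᵢ)·w = 0 for some r ∈ Γ \ {0} and some i, then t^r Kᵢ acts locally nilpotently on V₊; (3) for each r ∈ Γ, (t^r Kᵢ)^N · V₊ = 0 for all i = 1,…,n; (4) ((h₀⊗t^r)(h₀⊗t^s))·v = Λ(h₀)(h₀⊗t^{r+s})·v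 for all r, s ∈ Γ and v ∈ V₊. -/
open scoped BigOperators TensorProduct

noncomputable section

/-- Stage 1: a finite-dimensional simple complex Lie algebra `g` together with `n` commuting
automorphisms `σ i` of finite orders `m i`, fixed primitive roots of unity `ξ i`, and the
invariant nondegenerate symmetric bilinear form `bil`. -/
structure PreT where
  n : ℕ
  npos : 0 < n
  m : Fin n → ℕ
  mpos : ∀ i, 0 < m i
  g : Type
  [gLR : LieRing g]
  [gLA : LieAlgebra ℂ g]
  gfin : FiniteDimensional ℂ g
  gsimple : LieAlgebra.IsSimple ℂ g
  σ : Fin n → (g ≃ₗ⁅ℂ⁆ g)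
  σcomm : ∀ i j x, σ i (σ j x) = σ j (σ i x)
  σord : ∀ i x, (fun y => σ i y)^[m i] x = x
  ξ : Fin n → ℂ
  ξprim : ∀ i, IsPrimitiveRoot (ξ i) (m i)
  bil : g →ₗ[ℂ] g →ₗ[ℂ] ℂ
  bil_symm : ∀ x y, bil x y = bil y x
  bil_invariant : ∀ x y z, bil ⁅x, y⁆ z = bil x ⁅y, z⁆
  bil_nondeg : ∀ x, (∀ y, bil x y = 0) → x = 0
  bil_aut : ∀ i x y, bil (σ i x) (σ i y) = bil x y

attribute [instance] PreT.gLR PreT.gLA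

namespace PreT

variable (P : PreT)

/-- membership in the lattice `Γ = m₁ℤ ⊕ … ⊕ mₙℤ`. -/
def inΓ (r : Fin P.n → ℤ) : Prop := ∀ i, (P.m i : ℤ) ∣ r i

/-- the common eigenspace `𝔤_{k̄} = {x | σᵢ x = ξᵢ^{kᵢ} x}`. -/
def gr (k : Fin P.n → ℤ) : Submodule ℂ P.g :=
  ⨅ i, LinearMap.ker
    ((P.σ i).toLinearEquiv.toLinearMap - P.ξ i ^ (k i) • (1 : Module.End ℂ P.g))

/-- Ĝ-characters: group homomorphisms `ℤⁿ/Γ → ℂˣ` presented as `Γ`-periodic functions. -/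
def IsChar (χ : (Fin P.n → ℤ) → ℂ) : Prop :=
  (∀ k l, χ (k + l) = χ k * χ l) ∧ (∀ r, P.inΓ r → χ r = 1)

end PreT

/-- Stage 2: a Cartan subalgebra `h0 = 𝔥_{0̄}` of `𝔤_{0̄}` (abelian and self-normalizing
in `𝔤_{0̄}`). -/
structure Cartan (P : PreT) where
  h0 : Submodule ℂ P.g
  h0_le : h0 ≤ P.gr 0
  h0_ne : h0 ≠ ⊥
  h0_abelian : ∀ x ∈ h0, ∀ y ∈ h0, ⁅x, y⁆ = 0
  h0_selfnorm : ∀ x ∈ P.gr 0, (∀ h ∈ h0, ⁅h, x⁆ ∈ h0) → x ∈ h0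

namespace Cartan

variable {P : PreT} (C : Cartan P)

/-- the full weight space `{x ∈ 𝔤 | [h,x] = α(h)x ∀ h ∈ 𝔥_{0̄}}` of `𝔤` for `α ∈ 𝔥_{0̄}*`. -/
def wtfull (α : Module.Dual ℂ ↥C.h0) : Submodule ℂ P.g :=
  ⨅ h : ↥C.h0, LinearMap.ker
    (LieAlgebra.ad ℂ P.g (h : P.g) - α h • (1 : Module.End ℂ P.g))

/-- the root space `𝔤_{k̄}(α)`. -/
def wtg (k : Fin P.n → ℤ) (α : Module.Dual ℂ ↥C.h0) : Submodule ℂ P.g :=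
  P.gr k ⊓ C.wtfull α

/-- the set `Δ^× = Δ_{0,en}^×` of nonzero roots. -/
def Δen : Set (Module.Dual ℂ ↥C.h0) :=
  {α | α ≠ 0 ∧ ∃ k, C.wtg k α ≠ ⊥}

/-- weights for `h̃ = 𝔥_{0̄} ⊕ ⊕ᵢℂKᵢ ⊕ ⊕ᵢℂdᵢ`: a functional on `𝔥_{0̄}` together with the
values on `K₁,…,Kₙ` and on `d₁,…,dₙ`. -/
abbrev Wt : Type := Module.Dual ℂ ↥C.h0 × (Fin P.n → ℂ) × (Fin P.n → ℂ)

/-- a real root `γ = α + δ_k` of `τ̃`, regarded as an element of `h̃*`. -/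
def rootFn (α : Module.Dual ℂ ↥C.h0) (k : Fin P.n → ℤ) : C.Wt :=
  (α, 0, fun i => (k i : ℂ))

end Cartan

/-- Stage 3: the Lie-torus axioms together with a choice of a positive system and of coroots for
the (extended) root system `Δ_{0,en}`. -/
structure Torus (P : PreT) (C : Cartan P) where
  /-- `𝔤_{0̄}` is a (finite-dimensional) simple Lie algebra: no proper nonzero ideals … -/
  g0_ideals : ∀ U : Submodule ℂ P.g, U ≤ P.gr 0 →
    (∀ x ∈ P.gr 0, ∀ u ∈ U, ⁅x, u⁆ ∈ U) → U = ⊥ ∨ U = P.gr 0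
  /-- … and nonabelian. -/
  g0_nonabelian : ∃ x ∈ P.gr 0, ∃ y ∈ P.gr 0, ⁅x, y⁆ ≠ 0
  /-- condition (M): for `k̄ ≠ 0̄` with `𝔤_{k̄} ≠ 0`, `𝔤_{k̄} ≅ U ⊕ W` with `U` a trivial
  `𝔤_{0̄}`-module and `W` zero or irreducible of dimension `> 1` with weights in `Δ_{0,en}`. -/
  cond_M : ∀ k : Fin P.n → ℤ, ¬ P.inΓ k → P.gr k ≠ ⊥ →
    ∃ U W : Submodule ℂ P.g, U ≤ P.gr k ∧ W ≤ P.gr k ∧ U ⊓ W = ⊥ ∧ U ⊔ W = P.gr k ∧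
      (∀ x ∈ P.gr 0, ∀ u ∈ U, ⁅x, u⁆ = 0) ∧
      (W = ⊥ ∨
        ((∀ U' : Submodule ℂ P.g, U' ≤ W →
            (∀ x ∈ P.gr 0, ∀ u ∈ U', ⁅x, u⁆ ∈ U') → U' = ⊥ ∨ U' = W) ∧
          1 < Module.finrank ℂ ↥W ∧
          W ≤ ⨆ α ∈ insert (0 : Module.Dual ℂ ↥C.h0) C.Δen, C.wtfull α))
  /-- condition (iii): the group generated by `σ₁,…,σₙ` has order `m₁ ⋯ mₙ`. -/
  ord_faithful : ∀ k : Fin P.n → ℤ,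
    (∀ l, P.gr l ≠ ⊥ → (∏ i, P.ξ i ^ (k i * l i)) = 1) → P.inΓ k
  /-- a positive system for `Δ_{0,en}`. -/
  pos : Set (Module.Dual ℂ ↥C.h0)
  pos_sub : pos ⊆ C.Δen
  pos_total : ∀ α ∈ C.Δen, α ∈ pos ∨ -α ∈ pos
  pos_disj : ∀ α ∈ pos, -α ∉ pos
  pos_add : ∀ α ∈ pos, ∀ β ∈ pos, α + β ∈ C.Δen → α + β ∈ pos
  /-- coroots `α∨ ∈ 𝔥_{0̄}`. -/
  coroot : Module.Dual ℂ ↥C.h0 → ↥C.h0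
  coroot_two : ∀ α ∈ C.Δen, α (coroot α) = 2
  coroot_neg : ∀ α ∈ C.Δen, coroot (-α) = - coroot α
  /-- `cnorm α = 2/(α|α)`, characterized via the bilinear form. -/
  cnorm : Module.Dual ℂ ↥C.h0 → ℂ
  cnorm_spec : ∀ α ∈ C.Δen, ∀ h : ↥C.h0,
    P.bil ((coroot α : P.g)) ((h : P.g)) = cnorm α * α h

namespace Torus

variable {P : PreT} {C : Cartan P} (T : Torus P C)

/-- evaluation `λ(γ∨)` of a weight `λ` at the coroot `γ∨ = α∨ + (2/(α|α)) Σᵢ kᵢKᵢ` of the real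
root `γ = α + δ_k`. -/
def corootEval (α : Module.Dual ℂ ↥C.h0) (k : Fin P.n → ℤ) (w : C.Wt) : ℂ :=
  w.1 (T.coroot α) + T.cnorm α * ∑ i, (k i : ℂ) * w.2.1 i

/-- the reflection `r_γ(λ) = λ - λ(γ∨)γ` on `h̃*`. -/
def reflFn (α : Module.Dual ℂ ↥C.h0) (k : Fin P.n → ℤ) : Function.End C.Wt :=
  fun w => w - T.corootEval α k w • C.rootFn α k

/-- the Weyl group `W` of `τ̃`, generated by the reflections in the real roots
(realized inside the monoid of self-maps of `h̃*`; as the generators are involutions this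
coincides with the generated group). -/
def weyl : Submonoid (Function.End C.Wt) :=
  Submonoid.closure {f | ∃ α ∈ C.Δen, ∃ k, f = T.reflFn α k}

end Torus

/-- Stage 4: the twisted full toroidal Lie algebra
`τ̃ = LT ⊕ 𝒵(m) ⊕ 𝒟(m)`.  The elements `E k x` (for `x ∈ 𝔤_{k̄}`), `K r i` and `Dop r i`
(for `r ∈ Γ`) realize `x ⊗ t^k`, `t^r Kᵢ` and `t^r dᵢ`, subject to the standard toroidal
bracket relations, with 2-cocycle `φ = c1 • φ₁ + c2 • φ₂`. -/
structure Toroidal (P : PreT) (C : Cartan P) (T : Torus P C) where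
  τ : Type
  [τLR : LieRing τ]
  [τLA : LieAlgebra ℂ τ]
  E : (Fin P.n → ℤ) → P.g →ₗ[ℂ] τ
  K : (Fin P.n → ℤ) → Fin P.n → τ
  Dop : (Fin P.n → ℤ) → Fin P.n → τ
  c1 : ℂ
  c2 : ℂ
  K_not : ∀ r i, ¬ P.inΓ r → K r i = 0
  Dop_not : ∀ r i, ¬ P.inΓ r → Dop r i = 0
  /-- the relation `Σᵢ rᵢ t^r Kᵢ = 0` coming from `dA(m)` in `𝒵(m) = Ω_{A(m)}/dA(m)`. -/
  K_dA : ∀ r, P.inΓ r → ∑ i, (r i : ℂ) • K r i = 0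
  br_EE : ∀ k l x y, x ∈ P.gr k → y ∈ P.gr l →
    ⁅E k x, E l y⁆ = E (k + l) ⁅x, y⁆ + P.bil x y • ∑ i, (k i : ℂ) • K (k + l) i
  br_EK : ∀ k x, x ∈ P.gr k → ∀ r i, ⁅E k x, K r i⁆ = 0
  br_KK : ∀ r s i j, ⁅K r i, K s j⁆ = 0
  br_DK : ∀ r s, P.inΓ r → P.inΓ s → ∀ i j,
    ⁅Dop r i, K s j⁆ = (s i : ℂ) • K (r + s) j +
      (if i = j then (1 : ℂ) else 0) • ∑ p, (r p : ℂ) • K (r + s) p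
  br_DD : ∀ r s, P.inΓ r → P.inΓ s → ∀ i j,
    ⁅Dop r i, Dop s j⁆ = (s i : ℂ) • Dop (r + s) j - (r j : ℂ) • Dop (r + s) i +
      (c1 * (-(s i : ℂ) * (r j : ℂ)) + c2 * ((r i : ℂ) * (s j : ℂ))) •
        ∑ p, (r p : ℂ) • K (r + s) p
  br_DE : ∀ r, P.inΓ r → ∀ i k x, x ∈ P.gr k → ⁅Dop r i, E k x⁆ = (k i : ℂ) • E (r + k) x
  span_top : Submodule.span ℂ
    ({t | ∃ k x, x ∈ P.gr k ∧ t = E k x} ∪ {t | ∃ r i, P.inΓ r ∧ t = K r i} ∪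
      {t | ∃ r i, P.inΓ r ∧ t = Dop r i}) = ⊤
  E_inj : ∀ k x, x ∈ P.gr k → E k x = 0 → x = 0

attribute [instance] Toroidal.τLR Toroidal.τLA

namespace Toroidal

variable {P : PreT} {C : Cartan P} {T : Torus P C} (X : Toroidal P C T)

/-- the generators `𝔤_{k̄}(α) ⊗ ℂt^k`, `α` positive, of `τ̃₊`. -/
def tauP : Set X.τ :=
  {t | ∃ α ∈ T.pos, ∃ k x, x ∈ C.wtg k α ∧ t = X.E k x}

/-- the generators `𝔤_{k̄}(α) ⊗ ℂt^k`, `α` negative, of `τ̃₋`. -/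
def tauM : Set X.τ :=
  {t | ∃ α, -α ∈ T.pos ∧ ∃ k x, x ∈ C.wtg k α ∧ t = X.E k x}

/-- the generators `𝔤_{k̄}(0) ⊗ ℂt^k`, `t^rKᵢ`, `t^rdᵢ` of `τ̃₀`. -/
def tauZ : Set X.τ :=
  {t | (∃ k x, x ∈ C.wtg k 0 ∧ t = X.E k x) ∨
    (∃ r i, P.inΓ r ∧ (t = X.K r i ∨ t = X.Dop r i))}

/-- the generators of `τ̂ = LT ⊕ 𝒟(m)`. -/
def tauHat : Set X.τ :=
  {t | (∃ k x, x ∈ P.gr k ∧ t = X.E k x) ∨ (∃ r i, P.inΓ r ∧ t = X.Dop r i)}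

/-- the element `I(u,r) = D(u,r) - D(u,0) = Σᵢ uᵢ t^r dᵢ - Σᵢ uᵢ dᵢ`. -/
def Iop (u : Fin P.n → ℂ) (r : Fin P.n → ℤ) : X.τ :=
  ∑ i, u i • X.Dop r i - ∑ i, u i • X.Dop 0 i

/-- generators of `L̃ = I ⋉ L(g̊,σ)`, where `g̊` is the centralizer of `𝔥_{0̄}` in `𝔤`. -/
def Ltil : Set X.τ :=
  {t | (∃ u r, P.inΓ r ∧ t = X.Iop u r) ∨
    (∃ k x, x ∈ P.gr k ∧ x ∈ C.wtfull 0 ∧ t = X.E k x)}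

/-- generators of `I ⋉ (𝔥_{0̄} ⊗ A(m))`. -/
def IhGen : Set X.τ :=
  {t | (∃ u r, P.inΓ r ∧ t = X.Iop u r) ∨
    (∃ r h, P.inΓ r ∧ h ∈ C.h0 ∧ h ∈ P.gr r ∧ h ∈ C.wtfull 0 ∧ t = X.E r h)}

end Toroidal

/-- a representation of `τ̃` on a complex vector space. -/
structure TRep {P : PreT} {C : Cartan P} {T : Torus P C} (X : Toroidal P C T) where
  V : Type
  [Vadd : AddCommGroup V]
  [Vmod : Module ℂ V]
  ρ : X.τ →ₗ[ℂ] Module.End ℂ V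
  ρ_lie : ∀ a b : X.τ, ρ ⁅a, b⁆ = ρ a * ρ b - ρ b * ρ a

attribute [instance] TRep.Vadd TRep.Vmod

namespace TRep

variable {P : PreT} {C : Cartan P} {T : Torus P C} {X : Toroidal P C T} (M : TRep X)

/-- the weight space `V_w` with respect to `h̃`. -/
def wtSp (w : C.Wt) : Submodule ℂ M.V :=
  (⨅ h : ↥C.h0, LinearMap.ker (M.ρ (X.E 0 (h : P.g)) - w.1 h • (1 : Module.End ℂ M.V))) ⊓
  (⨅ i, LinearMap.ker (M.ρ (X.K 0 i) - w.2.1 i • (1 : Module.End ℂ M.V))) ⊓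
  (⨅ i, LinearMap.ker (M.ρ (X.Dop 0 i) - w.2.2 i • (1 : Module.End ℂ M.V)))

/-- the set `P(V)` of weights of `V`. -/
def wts : Set C.Wt := {w | M.wtSp w ≠ ⊥}

/-- `V` is a weight module: `V = ⊕_{λ ∈ h̃*} V_λ`. -/
def IsWeight : Prop := (⨆ w : C.Wt, M.wtSp w) = ⊤

/-- `V` has finite-dimensional weight spaces. -/
def FinWt : Prop := ∀ w : C.Wt, FiniteDimensional ℂ ↥(M.wtSp w)

/-- integrability: `V` is a weight module on which all the root vectors
`x ∈ 𝔤_{k̄}(α) ⊗ ℂt^k`, `α ≠ 0`, act locally nilpotently. -/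
def Integrable : Prop :=
  M.IsWeight ∧ ∀ (k : Fin P.n → ℤ) (α : Module.Dual ℂ ↥C.h0), α ≠ 0 →
    ∀ x ∈ C.wtg k α, ∀ v : M.V, ∃ N : ℕ, (M.ρ (X.E k x) ^ N) v = 0

/-- level zero: the central elements `K₁, …, Kₙ` act trivially. -/
def LevelZero : Prop := ∀ i, M.ρ (X.K 0 i) = 0

/-- irreducibility of `V` over `τ̃`. -/
def Irr : Prop :=
  Nontrivial M.V ∧
    ∀ U : Submodule ℂ M.V, (∀ t : X.τ, ∀ v ∈ U, M.ρ t v ∈ U) → U = ⊥ ∨ U = ⊤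

/-- the Lie torus `LT` acts non-trivially on `V`. -/
def LTnontrivial : Prop := ∃ k x, x ∈ P.gr k ∧ M.ρ (X.E k x) ≠ 0

/-- the highest weight space `V₊ = {v ∈ V | τ̃₊ ⬝ v = 0}`. -/
def Vplus : Submodule ℂ M.V := ⨅ t ∈ X.tauP, LinearMap.ker (M.ρ t)

/-- `U(τ̃₀)v`: the smallest subspace of `V` containing `v` and invariant under `τ̃₀`. -/
def u0span (v : M.V) : Submodule ℂ M.V :=
  sInf {U | v ∈ U ∧ ∀ t ∈ X.tauZ, ∀ u ∈ U, M.ρ t u ∈ U}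

/-- `V` is a level zero highest weight module for `τ̃` (Definition 3.3). -/
def IsHW : Prop :=
  ∃ v : M.V, v ≠ 0 ∧ (∃ w : C.Wt, v ∈ M.wtSp w) ∧
    (∀ U : Submodule ℂ M.V, (∀ t : X.τ, ∀ u ∈ U, M.ρ t u ∈ U) → v ∈ U → U = ⊤) ∧
    (∀ t ∈ X.tauP, M.ρ t v = 0) ∧
    (∀ U : Submodule ℂ M.V, U ≤ M.u0span v →
      (∀ t ∈ X.tauZ, ∀ u ∈ U, M.ρ t u ∈ U) → U = ⊥ ∨ U = M.u0span v) ∧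
    (∀ i, M.ρ (X.K 0 i) = 0)

/-- simultaneous eigenspace for the degree derivations `d₁,…,dₙ`. -/
def dEig (b : Fin P.n → ℂ) : Submodule ℂ M.V :=
  ⨅ i, LinearMap.ker (M.ρ (X.Dop 0 i) - b i • (1 : Module.End ℂ M.V))

/-- the graded piece `V₊(k) = {v ∈ V₊ | dᵢ v = (Λ(dᵢ)+kᵢ) v}`. -/
def VplusGr (Λ : C.Wt) (k : Fin P.n → ℤ) : Submodule ℂ M.V :=
  M.Vplus ⊓ M.dEig (fun i => Λ.2.2 i + (k i : ℂ))

/-- `𝒵(m)` acts trivially on `V`. -/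
def Ztrivial : Prop := ∀ r, P.inΓ r → ∀ i, M.ρ (X.K r i) = 0

end TRep

/-- isomorphism of representations of `τ̃`. -/
def TRepIso {P : PreT} {C : Cartan P} {T : Torus P C} {X : Toroidal P C T}
    (M N : TRep X) : Prop :=
  ∃ e : M.V ≃ₗ[ℂ] N.V, ∀ t v, e (M.ρ t v) = N.ρ t (e v)

section General

variable {V : Type*} [AddCommGroup V] [Module ℂ V]

/-- Joint eigenvectors of a family of endomorphisms with distinct joint eigenvalues are
linearly independent. -/
lemma joint_eigen_sum_eq_zero {A ι : Type*} (f : ι → Module.End ℂ V) (c : A → ι → ℂ)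
    (hc : Function.Injective c) (s : Finset A) :
    ∀ x : A → V, (∀ a ∈ s, ∀ i, f i (x a) = c a i • x a) → ∑ a ∈ s, x a = 0 →
      ∀ a ∈ s, x a = 0 := by
  classical
  induction s using Finset.induction_on with
  | empty => simp
  | insert b s hb ih =>
    intro x hx h
    have key : ∀ a ∈ s, x a = 0 := by
      intro a ha
      obtain ⟨i, hi⟩ : ∃ i, c a i ≠ c b i := by
        by_contra! hcon
        exact hb (hc (funext hcon) ▸ ha)
      have h1 : ∑ a ∈ s, (c a i - c b i) • x a = 0 := by
        have h2 : f i (∑ a ∈ insert b s, x a) - c b i • ∑ a ∈ insert b s, x a = 0 := by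
          rw [h]; simp
        rw [map_sum, Finset.smul_sum, ← Finset.sum_sub_distrib, Finset.sum_insert hb,
          hx b (Finset.mem_insert_self _ _) i, sub_self, zero_add] at h2
        rw [← h2]
        refine Finset.sum_congr rfl fun a ha => ?_
        rw [hx a (Finset.mem_insert_of_mem ha) i, sub_smul]
      have h3 := ih (fun a => (c a i - c b i) • x a) (fun a ha j => by
        rw [map_smul, hx a (Finset.mem_insert_of_mem ha) j, smul_comm]) h1 a ha
      exact (smul_eq_zero.mp h3).resolve_left (sub_ne_zero.mpr hi)
    intro a ha
    rcases Finset.mem_insert.mp ha with rfl | ha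
    · rwa [Finset.sum_insert hb, Finset.sum_eq_zero key, add_zero] at h
    · exact key a ha

/-- Elements of a supremum of subspaces as finite sums. -/
lemma exists_sum_of_mem_iSup {A : Type*} (p : A → Submodule ℂ V) {x : V} (hx : x ∈ ⨆ a, p a) :
    ∃ (s : Finset A) (y : A → V), (∀ a, y a ∈ p a) ∧ ∑ a ∈ s, y a = x := by
  obtain ⟨f, hf, rfl⟩ := (Submodule.mem_iSup_iff_exists_finsupp p x).mp hx
  exact ⟨f.support, f, hf, rfl⟩

/-- Commuting endomorphisms of finite order are simultaneously diagonalizable. -/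
lemma iSup_joint_eigen_finite_order [FiniteDimensional ℂ V] {ι : Type*}
    (f : ι → Module.End ℂ V) (hcomm : ∀ i j, Commute (f i) (f j)) (m : ι → ℕ)
    (hm : ∀ i, 0 < m i) (hf : ∀ i, f i ^ m i = 1) (ξ : ι → ℂ)
    (hξ : ∀ i, IsPrimitiveRoot (ξ i) (m i)) :
    ⨆ k : ι → ℤ, ⨅ i, (f i).eigenspace (ξ i ^ k i) = ⊤ := by
  have hss : ∀ i, (f i).IsFinitelySemisimple := fun i => by
    rw [Module.End.isFinitelySemisimple_iff_isSemisimple]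
    refine Module.End.isSemisimple_of_squarefree_aeval_eq_zero
      (p := Polynomial.X ^ m i - 1) ?_ (by simp [hf])
    have := Polynomial.separable_X_pow_sub_C (1 : ℂ) (n := m i)
      (by exact_mod_cast (hm i).ne') one_ne_zero
    simpa using this.squarefree
  have h1 := Module.End.iSup_iInf_maxGenEigenspace_eq_top_of_iSup_maxGenEigenspace_eq_top_of_commute
    f (fun i j _ => hcomm i j) (fun i => Module.End.iSup_maxGenEigenspace_eq_top (f i))
  rw [eq_top_iff, ← h1]
  refine iSup_le fun χ => ?_
  simp only [(hss _).maxGenEigenspace_eq_eigenspace]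
  by_cases hbot : (⨅ i, (f i).eigenspace (χ i)) = ⊥
  · rw [hbot]; exact bot_le
  obtain ⟨v, hv, hv0⟩ := Submodule.exists_mem_ne_zero_of_ne_bot hbot
  have hroot : ∀ i, ∃ k : ℤ, ξ i ^ k = χ i := fun i => by
    have hvi : f i v = χ i • v :=
      Module.End.mem_eigenspace_iff.mp ((Submodule.mem_iInf _).mp hv i)
    have hp : ∀ j : ℕ, (f i ^ j) v = χ i ^ j • v := fun j => by
      induction j with
      | zero => simp
      | succ j ih => rw [pow_succ', Module.End.mul_apply, ih, map_smul, hvi, smul_smul, pow_succ]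
    have h2 : χ i ^ m i = 1 := by
      have := hp (m i)
      rw [hf, Module.End.one_apply] at this
      have h3 : (χ i ^ m i - 1) • v = 0 := by rw [sub_smul, ← this]; simp
      exact sub_eq_zero.mp ((smul_eq_zero.mp h3).resolve_right hv0)
    have : NeZero (m i) := ⟨(hm i).ne'⟩
    obtain ⟨j, -, hj⟩ := (hξ i).eq_pow_of_pow_eq_one h2
    exact ⟨j, by simpa using hj⟩
  choose k hk using hroot
  refine le_iSup_of_le k ?_
  simp only [hk]
  exact le_rfl

end General

namespace PreT

variable {P : PreT}

lemma mem_gr {k : Fin P.n → ℤ} {x : P.g} : x ∈ P.gr k ↔ ∀ i, P.σ i x = P.ξ i ^ k i • x := by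
  simp only [gr, Submodule.mem_iInf, LinearMap.mem_ker, LinearMap.sub_apply, sub_eq_zero]
  rfl

lemma ξ_ne_zero (i : Fin P.n) : P.ξ i ≠ 0 := (P.ξprim i).ne_zero (P.mpos i).ne'

lemma inΓ_zero : P.inΓ 0 := fun _ => dvd_zero _

lemma inΓ_add {r s : Fin P.n → ℤ} (hr : P.inΓ r) (hs : P.inΓ s) : P.inΓ (r + s) :=
  fun i => dvd_add (hr i) (hs i)

lemma inΓ_neg {r : Fin P.n → ℤ} (hr : P.inΓ r) : P.inΓ (-r) :=
  fun i => (dvd_neg (a := (P.m i : ℤ))).mpr (hr i)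

lemma inΓ_sub {r s : Fin P.n → ℤ} (hr : P.inΓ r) (hs : P.inΓ s) : P.inΓ (r - s) :=
  fun i => dvd_sub (hr i) (hs i)

lemma inΓ_zsmul {r : Fin P.n → ℤ} (c : ℤ) (hr : P.inΓ r) : P.inΓ (c • r) :=
  fun i => Dvd.dvd.mul_left (hr i) c

lemma inΓ_nsmul {r : Fin P.n → ℤ} (c : ℕ) (hr : P.inΓ r) : P.inΓ (c • r) := by
  simpa using inΓ_zsmul (c : ℤ) hr

lemma gr_add_right {r : Fin P.n → ℤ} (hr : P.inΓ r) (k : Fin P.n → ℤ) :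
    P.gr (k + r) = P.gr k := by
  ext x
  simp only [mem_gr]
  refine forall_congr' fun i => ?_
  rw [Pi.add_apply, zpow_add₀ (ξ_ne_zero i), ((P.ξprim i).zpow_eq_one_iff_dvd _).mpr (hr i),
    mul_one]

lemma gr_of_inΓ {r : Fin P.n → ℤ} (hr : P.inΓ r) : P.gr r = P.gr 0 := by
  simpa using gr_add_right hr 0

lemma lie_mem_gr {k l : Fin P.n → ℤ} {x y : P.g} (hx : x ∈ P.gr k) (hy : y ∈ P.gr l) :
    ⁅x, y⁆ ∈ P.gr (k + l) := by
  rw [mem_gr] at *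
  intro i
  rw [LieEquiv.map_lie, hx, hy, smul_lie, lie_smul, smul_smul, Pi.add_apply,
    zpow_add₀ (ξ_ne_zero i)]

lemma bil_gr {k l : Fin P.n → ℤ} {x y : P.g} (hx : x ∈ P.gr k) (hy : y ∈ P.gr l)
    (h : P.bil x y ≠ 0) : P.inΓ (k + l) := by
  rw [mem_gr] at *
  intro i
  have := P.bil_aut i x y
  rw [hx, hy, map_smul, map_smul, LinearMap.smul_apply, smul_smul, ← zpow_add₀ (ξ_ne_zero i)]
    at this
  rw [← (P.ξprim i).zpow_eq_one_iff_dvd, Pi.add_apply, add_comm]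
  exact mul_right_cancel₀ h (by simpa using this)

lemma iSup_gr : ⨆ k, P.gr k = ⊤ := by
  have := P.gfin
  have h := iSup_joint_eigen_finite_order (fun i => (P.σ i).toLinearEquiv.toLinearMap)
    (fun i j => by
      ext x
      exact P.σcomm i j x) P.m P.mpos (fun i => by
      ext x
      rw [Module.End.pow_apply]
      exact P.σord i x) P.ξ P.ξprim
  rw [← h]
  congr 1
  ext k x
  rw [mem_gr]
  simp only [Submodule.mem_iInf, Module.End.mem_eigenspace_iff]
  rfl

end PreT

namespace Cartan

variable {P : PreT} {C : Cartan P}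

open PreT

lemma mem_wtfull {α : Module.Dual ℂ ↥C.h0} {x : P.g} :
    x ∈ C.wtfull α ↔ ∀ h : ↥C.h0, ⁅(h : P.g), x⁆ = α h • x := by
  simp only [wtfull, Submodule.mem_iInf, LinearMap.mem_ker, LinearMap.sub_apply, sub_eq_zero]
  rfl

lemma lie_mem_wtfull {α β : Module.Dual ℂ ↥C.h0} {x y : P.g} (hx : x ∈ C.wtfull α)
    (hy : y ∈ C.wtfull β) : ⁅x, y⁆ ∈ C.wtfull (α + β) := by
  rw [mem_wtfull] at *
  intro h
  rw [leibniz_lie, hx, hy, smul_lie, lie_smul, ← add_smul]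
  rfl

lemma lie_mem_wtg {k l : Fin P.n → ℤ} {α β : Module.Dual ℂ ↥C.h0} {x y : P.g}
    (hx : x ∈ C.wtg k α) (hy : y ∈ C.wtg l β) : ⁅x, y⁆ ∈ C.wtg (k + l) (α + β) :=
  ⟨lie_mem_gr hx.1 hy.1, lie_mem_wtfull hx.2 hy.2⟩

lemma bil_wtfull {α β : Module.Dual ℂ ↥C.h0} {x y : P.g} (hx : x ∈ C.wtfull α)
    (hy : y ∈ C.wtfull β) (h : P.bil x y ≠ 0) : α + β = 0 := by
  rw [mem_wtfull] at *
  ext t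
  have h1 := P.bil_invariant x t y
  rw [hy, ← lie_skew, hx, map_neg, map_smul, map_smul, LinearMap.neg_apply, LinearMap.smul_apply,
    smul_eq_mul, smul_eq_mul] at h1
  have : (α t + β t) * P.bil x y = 0 := by linear_combination -h1
  simpa using (mul_eq_zero.mp this).resolve_right h

lemma h0_le_wtfull : C.h0 ≤ C.wtfull 0 := fun x hx => by
  rw [mem_wtfull]
  intro h
  rw [C.h0_abelian _ h.2 _ hx]; simp

lemma h0_le_wtg : C.h0 ≤ C.wtg 0 0 := fun _ hx => ⟨C.h0_le hx, h0_le_wtfull hx⟩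

lemma wtg_zero : C.wtg 0 0 = C.h0 := by
  refine le_antisymm (fun x hx => C.h0_selfnorm x hx.1 fun h hh => ?_) h0_le_wtg
  rw [mem_wtfull.mp hx.2 ⟨h, hh⟩]
  simp

lemma σ_mem_wtfull {α : Module.Dual ℂ ↥C.h0} {x : P.g} (hx : x ∈ C.wtfull α) (i : Fin P.n) :
    P.σ i x ∈ C.wtfull α := by
  rw [mem_wtfull] at *
  intro h
  have hh : P.σ i (h : P.g) = h := by simpa using mem_gr.mp (C.h0_le h.2) i
  conv_lhs => rw [← hh]
  rw [← LieEquiv.map_lie, hx, map_smul]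

/-- A homogeneous element in the sum of the `𝔥_{0̄}`-weight spaces is the sum of its homogeneous
weight components. -/
lemma mem_iSup_wtg {k : Fin P.n → ℤ} {x : P.g} (hx : x ∈ P.gr k) (hS : x ∈ ⨆ α, C.wtfull α) :
    x ∈ ⨆ α, C.wtg k α := by
  obtain ⟨s, y, hy, rfl⟩ := exists_sum_of_mem_iSup _ hS
  refine Submodule.sum_mem _ fun α hα => Submodule.mem_iSup_of_mem α ⟨mem_gr.mpr fun i => ?_, hy α⟩
  rw [← sub_eq_zero]
  refine joint_eigen_sum_eq_zero (fun h : ↥C.h0 => LieAlgebra.ad ℂ P.g (h : P.g))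
    (fun (α : Module.Dual ℂ ↥C.h0) h => α h) (fun a b hab => DFunLike.coe_injective hab) s
    (fun α => P.σ i (y α) - P.ξ i ^ k i • y α) (fun α _ h => ?_) ?_ α hα
  · exact mem_wtfull.mp (Submodule.sub_mem _ (σ_mem_wtfull (hy α) i)
      (Submodule.smul_mem _ _ (hy α))) h
  · rw [Finset.sum_sub_distrib, ← Finset.smul_sum, ← map_sum, mem_gr.mp hx i, sub_self]

end Cartan

/-- In a finite-dimensional simple complex Lie algebra, every element is a sum of joint
eigenvectors for an abelian self-normalizing subalgebra. -/
lemma iSup_joint_eigen_of_isSimple {L : Type*} [LieRing L] [LieAlgebra ℂ L]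
    [FiniteDimensional ℂ L] [LieAlgebra.IsSimple ℂ L] (H : LieSubalgebra ℂ L)
    (hab : ∀ x ∈ H, ∀ y ∈ H, ⁅x, y⁆ = 0)
    (hself : ∀ x : L, (∀ h ∈ H, ⁅h, x⁆ ∈ H) → x ∈ H) (x : L) :
    x ∈ ⨆ α : Module.Dual ℂ H, ⨅ h : H,
      LinearMap.ker (LieAlgebra.ad ℂ L (h : L) - α h • (1 : Module.End ℂ L)) := by
  have hcartan : H.IsCartanSubalgebra :=
    { nilpotent := by
        have : IsLieAbelian H := ⟨fun a b => Subtype.ext (hab a a.2 b b.2)⟩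
        infer_instance
      self_normalizing := by
        refine le_antisymm (fun y hy => ?_) H.le_normalizer
        exact hself y fun h hh => (H.mem_normalizer_iff' y).mp hy h hh }
  have htop := LieModule.iSup_genWeightSpace_eq_top' ℂ H L
  have hx : x ∈ (⨆ χ : LieModule.Weight ℂ H L, LieModule.genWeightSpace L χ :
    LieSubmodule ℂ H L) := by rw [htop]; trivial
  rw [← LieSubmodule.mem_toSubmodule, LieSubmodule.iSup_toSubmodule] at hx
  revert hx
  refine fun hx => SetLike.le_def.mp (iSup_le fun χ => ?_) hx
  refine le_iSup_of_le (LieModule.Weight.toLinear ℂ H L χ) fun y hy => ?_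
  simp only [Submodule.mem_iInf, LinearMap.mem_ker, LinearMap.sub_apply, sub_eq_zero]
  intro h
  exact LieAlgebra.IsKilling.lie_eq_smul_of_mem_rootSpace hy h

namespace Torus

variable {P : PreT} {C : Cartan P} (T : Torus P C)

open PreT Cartan

/-- The fixed-point subalgebra `𝔤_{0̄}`. -/
def g0 (P : PreT) : LieSubalgebra ℂ P.g :=
  { P.gr 0 with lie_mem' := fun {x y} hx hy => by simpa using! lie_mem_gr hx hy }

include T in
lemma g0_isSimple : LieAlgebra.IsSimple ℂ (g0 P) where
  eq_bot_or_eq_top I := by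
    have key := T.g0_ideals (I.toSubmodule.map (g0 P).toSubmodule.subtype)
      (by
        rintro _ ⟨y, -, rfl⟩
        exact y.2)
      (by
        rintro x hx _ ⟨y, hy, rfl⟩
        exact ⟨⁅(⟨x, hx⟩ : g0 P), y⁆, lie_mem_right ℂ _ I _ _ hy, rfl⟩)
    rcases key with h | h
    · left
      rw [eq_bot_iff]
      intro y hy
      have : (y : P.g) ∈ I.toSubmodule.map (g0 P).toSubmodule.subtype := ⟨y, hy, rfl⟩
      rw [h, Submodule.mem_bot] at this
      exact (LieSubmodule.mem_bot _).mpr (Subtype.ext this)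
    · right
      rw [eq_top_iff]
      intro y _
      have : (y : P.g) ∈ I.toSubmodule.map (g0 P).toSubmodule.subtype := h ▸ y.2
      obtain ⟨z, hz, hzy⟩ := this
      have : z = y := Subtype.ext hzy
      exact this ▸ hz
  non_abelian := by
    intro hab
    obtain ⟨x, hx, y, hy, hxy⟩ := T.g0_nonabelian
    exact hxy (congrArg Subtype.val (hab.trivial ⟨x, hx⟩ ⟨y, hy⟩))

include T in
lemma g0_le_iSup : P.gr 0 ≤ ⨆ α, C.wtfull α := by
  intro x hx
  have := P.gfin
  have := T.g0_isSimple
  have hfd : FiniteDimensional ℂ (g0 P) :=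
    inferInstanceAs (FiniteDimensional ℂ (g0 P).toSubmodule)
  let H : LieSubalgebra ℂ (g0 P) :=
    { C.h0.comap (g0 P).toSubmodule.subtype with
      lie_mem' := fun {a b} ha hb => by
        have : ⁅(a : P.g), (b : P.g)⁆ = 0 := C.h0_abelian _ ha _ hb
        change ((⁅a, b⁆ : g0 P) : P.g) ∈ C.h0
        rw [LieSubalgebra.coe_bracket, this]
        exact C.h0.zero_mem }
  have hH : ∀ a : g0 P, a ∈ H ↔ (a : P.g) ∈ C.h0 := fun _ => Iff.rfl
  have key := iSup_joint_eigen_of_isSimple H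
    (fun a ha b hb => Subtype.ext (C.h0_abelian _ ha _ hb))
    (fun a ha => C.h0_selfnorm a a.2 fun h hh => ha ⟨h, C.h0_le hh⟩ hh) ⟨x, hx⟩
  obtain ⟨s, y, hy, hsum⟩ := exists_sum_of_mem_iSup _ key
  have hx' : x = ∑ α ∈ s, ((y α : g0 P) : P.g) := by
    have := congrArg (g0 P).toSubmodule.subtype hsum
    rw [map_sum] at this
    exact this.symm
  rw [hx']
  refine Submodule.sum_mem _ fun α _ => ?_
  let ι : ↥C.h0 →ₗ[ℂ] H :=
    { toFun := fun h => ⟨⟨h, C.h0_le h.2⟩, h.2⟩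
      map_add' := fun _ _ => rfl
      map_smul' := fun _ _ => rfl }
  refine Submodule.mem_iSup_of_mem (α.comp ι) (mem_wtfull.mpr fun h => ?_)
  have h1 := (Submodule.mem_iInf _).mp (hy α) (ι h)
  rw [LinearMap.mem_ker, LinearMap.sub_apply, sub_eq_zero] at h1
  exact congrArg Subtype.val h1

include T in
lemma gr_le_iSup (k : Fin P.n → ℤ) : P.gr k ≤ ⨆ α, C.wtfull α := by
  by_cases hk : P.inΓ k
  · rw [gr_of_inΓ hk]
    exact T.g0_le_iSup
  by_cases hbot : P.gr k = ⊥
  · rw [hbot]; exact bot_le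
  obtain ⟨U, W, -, -, -, hUW, hU, hW⟩ := T.cond_M k hk hbot
  rw [← hUW]
  refine sup_le (fun u hu => ?_) ?_
  · refine Submodule.mem_iSup_of_mem 0 (mem_wtfull.mpr fun h => ?_)
    rw [hU _ (C.h0_le h.2) u hu]; simp
  · rcases hW with rfl | ⟨-, -, hW⟩
    · exact bot_le
    · exact hW.trans (iSup₂_le fun α _ => le_iSup _ α)

include T in
lemma gr_le_iSup_wtg (k : Fin P.n → ℤ) : P.gr k ≤ ⨆ α, C.wtg k α :=
  fun _ hx => mem_iSup_wtg hx (T.gr_le_iSup k hx)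

include T in
lemma iSup_wtg : ⨆ k, ⨆ α, C.wtg k α = ⊤ := by
  rw [eq_top_iff, ← iSup_gr (P := P)]
  exact iSup_mono fun k => T.gr_le_iSup_wtg k

include T in
lemma exists_bil_ne_zero {k : Fin P.n → ℤ} {α : Module.Dual ℂ ↥C.h0} {x : P.g}
    (hx : x ∈ C.wtg k α) (hx0 : x ≠ 0) : ∃ y ∈ C.wtg (-k) (-α), P.bil x y ≠ 0 := by
  by_contra! hcon
  refine hx0 (P.bil_nondeg x fun y => ?_)
  have hle : (⨆ k, ⨆ α, C.wtg k α) ≤ LinearMap.ker (P.bil x) := by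
    refine iSup₂_le fun l β y hy => ?_
    rw [LinearMap.mem_ker]
    by_contra hne
    have h1 := bil_wtfull hx.2 hy.2 hne
    have h2 := bil_gr hx.1 hy.1 hne
    refine hne (hcon y ⟨?_, ?_⟩)
    · have : P.gr (-k) = P.gr l := by
        rw [← gr_add_right h2 (-k)]; congr 1; abel
      rw [this]; exact hy.1
    · rw [neg_eq_of_add_eq_zero_right h1]; exact hy.2
  rw [T.iSup_wtg] at hle
  exact hle Submodule.mem_top

include T in
lemma bil_h0_nondeg {x : P.g} (hx : x ∈ C.h0) (h : ∀ y ∈ C.h0, P.bil x y = 0) : x = 0 := by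
  by_contra hx0
  obtain ⟨y, hy, hne⟩ := T.exists_bil_ne_zero (h0_le_wtg hx) hx0
  rw [neg_zero, neg_zero, wtg_zero] at hy
  exact hne (h y hy)

/-- The bracket of opposite weight vectors. -/
lemma lie_opposite {k : Fin P.n → ℤ} {α : Module.Dual ℂ ↥C.h0} (hα : α ∈ C.Δen) {x y : P.g}
    (hx : x ∈ C.wtg k α) (hy : y ∈ C.wtg (-k) (-α)) :
    T.cnorm α • ⁅x, y⁆ = P.bil x y • (T.coroot α : P.g) := by
  have h0 : ⁅x, y⁆ ∈ C.h0 := by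
    rw [← wtg_zero]; simpa using lie_mem_wtg hx hy
  rw [← sub_eq_zero]
  refine T.bil_h0_nondeg (C.h0.sub_mem (C.h0.smul_mem _ h0) (C.h0.smul_mem _ (T.coroot α).2))
    fun h hh => ?_
  have h1 := T.cnorm_spec α hα ⟨h, hh⟩
  have h2 : P.bil ⁅x, y⁆ h = α ⟨h, hh⟩ * P.bil x y := by
    rw [P.bil_invariant, ← lie_skew, mem_wtfull.mp hy.2 ⟨h, hh⟩]
    simp
  simp only [map_sub, map_smul, LinearMap.sub_apply, LinearMap.smul_apply, smul_eq_mul, h2]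
  rw [h1]; ring

lemma cnorm_ne_zero {α : Module.Dual ℂ ↥C.h0} (hα : α ∈ C.Δen) : T.cnorm α ≠ 0 := by
  intro h
  have h1 : (T.coroot α : P.g) = 0 := T.bil_h0_nondeg (T.coroot α).2 fun y hy => by
    rw [T.cnorm_spec α hα ⟨y, hy⟩, h, zero_mul]
  have h2 := T.coroot_two α hα
  rw [show T.coroot α = 0 from Subtype.ext h1, map_zero] at h2
  norm_num at h2

lemma exists_sl2 {α : Module.Dual ℂ ↥C.h0} (hα : α ∈ C.Δen) :
    ∃ k, ∃ e ∈ C.wtg k α, ∃ f ∈ C.wtg (-k) (-α),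
      IsSl2Triple (T.coroot α : P.g) e f := by
  obtain ⟨k, hk⟩ := hα.2
  obtain ⟨x, hx, hx0⟩ := Submodule.exists_mem_ne_zero_of_ne_bot hk
  obtain ⟨y, hy, hxy⟩ := T.exists_bil_ne_zero hx hx0
  have hc := T.cnorm_ne_zero hα
  refine ⟨k, x, hx, (T.cnorm α / P.bil x y) • y, Submodule.smul_mem _ _ hy, ?_, ?_, ?_, ?_⟩
  · intro h
    have h2 := T.coroot_two α hα
    rw [show T.coroot α = 0 from Subtype.ext h, map_zero] at h2
    norm_num at h2
  · rw [lie_smul, div_eq_inv_mul, mul_smul, T.lie_opposite hα hx hy, smul_smul,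
      inv_mul_cancel₀ hxy, one_smul]
  · rw [mem_wtfull.mp hx.2, T.coroot_two α hα, two_smul, two_nsmul]
  · rw [lie_smul, mem_wtfull.mp hy.2, LinearMap.neg_apply, T.coroot_two α hα, smul_comm, neg_smul,
      two_smul, two_nsmul]

/-- Root strings: integrality and addition of roots. -/
lemma root_string {α β : Module.Dual ℂ ↥C.h0} (hα : α ∈ C.Δen) (hβ : β ∈ C.Δen) :
    ∃ c : ℤ, β (T.coroot α) = c ∧ (c < 0 → β + α = 0 ∨ β + α ∈ C.Δen) := by
  have := P.gfin
  obtain ⟨k, e, he, f, hf, ht⟩ := T.exists_sl2 hα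
  obtain ⟨l, hl⟩ := hβ.2
  obtain ⟨x, hx, hx0⟩ := Submodule.exists_mem_ne_zero_of_ne_bot hl
  have hmem : ∀ j : ℕ, ((LieAlgebra.ad ℂ P.g e) ^ j) x ∈ C.wtg (l + j • k) (β + j • α) := by
    intro j
    induction j with
    | zero => simpa using hx
    | succ j ih =>
      rw [pow_succ', Module.End.mul_apply, LieAlgebra.ad_apply]
      have := lie_mem_wtg he ih
      convert this using 1
      rw [succ_nsmul', succ_nsmul']
      congr 1 <;> abel
  have hex : ∃ j : ℕ, ((LieAlgebra.ad ℂ P.g e) ^ j) x = 0 := by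
    by_contra! hcon
    have hinj : Function.Injective fun j : ℕ => β + j • α := by
      intro i j hij
      have h1 := add_left_cancel hij
      have h2 := LinearMap.congr_fun h1 (T.coroot α)
      rw [LinearMap.smul_apply, LinearMap.smul_apply, T.coroot_two α hα] at h2
      have : (i : ℂ) = j := by
        have h3 : (i : ℂ) * 2 = j * 2 := by simpa using h2
        exact mul_right_cancel₀ two_ne_zero h3
      exact_mod_cast this
    have hli : LinearIndependent ℂ fun j : ℕ => ((LieAlgebra.ad ℂ P.g e) ^ j) x := by
      rw [linearIndependent_iff']
      intro s g hg i hi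
      have := joint_eigen_sum_eq_zero (fun h : ↥C.h0 => LieAlgebra.ad ℂ P.g (h : P.g))
        (fun (j : ℕ) h => (β + j • α) h) (fun a b hab => hinj (DFunLike.coe_injective hab)) s
        (fun j => g j • ((LieAlgebra.ad ℂ P.g e) ^ j) x) (fun j _ h =>
          mem_wtfull.mp (Submodule.smul_mem _ _ (hmem j).2) h) hg i hi
      exact (smul_eq_zero.mp this).resolve_right (hcon i)
    exact not_finite_iff_infinite.mpr inferInstance hli.finite
  obtain ⟨n, hn, hn'⟩ := Nat.exists_not_and_succ_of_not_zero_of_exists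
    (p := fun j => ((LieAlgebra.ad ℂ P.g e) ^ j) x = 0) (by simpa using hx0) hex
  have hprim : ht.HasPrimitiveVectorWith (((LieAlgebra.ad ℂ P.g e) ^ n) x)
      ((β + n • α) (T.coroot α)) :=
    ⟨hn, mem_wtfull.mp (hmem n).2 _, by
      rw [pow_succ', Module.End.mul_apply] at hn'
      exact hn'⟩
  obtain ⟨N, hN⟩ := hprim.exists_nat
  have hval : β (T.coroot α) = ((N : ℤ) - 2 * n : ℤ) := by
    have h1 : (β + n • α) (T.coroot α) = β (T.coroot α) + n * 2 := by
      rw [LinearMap.add_apply, LinearMap.smul_apply, T.coroot_two α hα, nsmul_eq_mul]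
    rw [h1] at hN
    push_cast
    linear_combination hN
  refine ⟨(N : ℤ) - 2 * n, hval, fun hneg => ?_⟩
  have hn0 : n ≠ 0 := by
    rintro rfl
    simp at hneg
    omega
  have hne : ((LieAlgebra.ad ℂ P.g e) ^ 1) x ≠ 0 := by
    intro h
    apply hn
    obtain ⟨n, rfl⟩ := Nat.exists_eq_succ_of_ne_zero hn0
    rw [Nat.succ_eq_add_one, pow_add, Module.End.mul_apply, h, map_zero]
  by_cases h0 : β + α = 0
  · exact Or.inl h0
  · refine Or.inr ⟨h0, l + k, fun hbot => hne ?_⟩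
    have := hmem 1
    rw [one_smul, one_smul, hbot] at this
    exact this

/-- A nonempty sum of positive roots is nonzero. -/
lemma sum_pos_ne_zero (n : ℕ) : ∀ s : Multiset (Module.Dual ℂ ↥C.h0), s.card = n + 1 →
    (∀ α ∈ s, α ∈ T.pos) → s.sum ≠ 0 := by
  classical
  induction n with
  | zero =>
    intro s hs hpos hsum
    obtain ⟨α, rfl⟩ := Multiset.card_eq_one.mp hs
    rw [Multiset.sum_singleton] at hsum
    exact (T.pos_sub (hpos α (by simp))).1 hsum
  | succ n ih =>
    intro s hs hpos hsum
    obtain ⟨α, hαs⟩ := Multiset.card_pos_iff_exists_mem.mp (by omega : 0 < s.card)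
    obtain ⟨s', rfl⟩ := Multiset.exists_cons_of_mem hαs
    have hα := hpos α (by simp)
    have hα' := T.pos_sub hα
    have hex : ∃ β ∈ s', ∃ c : ℤ, β (T.coroot α) = c ∧ c < 0 := by
      by_contra! hcon
      have hnn : ∀ t : Multiset (Module.Dual ℂ ↥C.h0), t ≤ s' →
          ∃ c : ℤ, t.sum (T.coroot α) = c ∧ 0 ≤ c := by
        intro t
        induction t using Multiset.induction_on with
        | empty => intro _; exact ⟨0, by simp, le_rfl⟩
        | cons β t iht =>
          intro hle
          obtain ⟨c, hc, hc0⟩ := iht ((Multiset.le_cons_self t β).trans hle)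
          have hβ : β ∈ s' := Multiset.mem_of_le hle (Multiset.mem_cons_self β t)
          obtain ⟨d, hd, -⟩ := T.root_string hα'
            (T.pos_sub (hpos β (Multiset.mem_cons_of_mem hβ)))
          refine ⟨d + c, ?_, add_nonneg (hcon β hβ d hd) hc0⟩
          rw [Multiset.sum_cons, LinearMap.add_apply, hc, hd]; push_cast; rfl
      obtain ⟨c, hc, hc0⟩ := hnn s' le_rfl
      have h1 := LinearMap.congr_fun hsum (T.coroot α)
      rw [Multiset.sum_cons, LinearMap.add_apply, hc, T.coroot_two α hα', LinearMap.zero_apply]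
        at h1
      have h2 : (2 : ℤ) + c = 0 := by exact_mod_cast h1
      omega
    obtain ⟨β, hβ, c, hc, hc0⟩ := hex
    have hβp := hpos β (Multiset.mem_cons_of_mem hβ)
    obtain ⟨d, hd, hdd⟩ := T.root_string hα' (T.pos_sub hβp)
    have hdc : d = c := by exact_mod_cast (hd.symm.trans hc)
    obtain ⟨t, rfl⟩ := Multiset.exists_cons_of_mem hβ
    have hsumpos : β + α ∈ T.pos := by
      rcases hdd (hdc ▸ hc0) with h | h
      · exact absurd (neg_eq_of_add_eq_zero_left h ▸ hβp) (T.pos_disj α hα)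
      · exact T.pos_add β hβp α hα h
    refine ih ((β + α) ::ₘ t) (by simpa using hs) (fun γ hγ => ?_) ?_
    · rcases Multiset.mem_cons.mp hγ with rfl | hγ
      · exact hsumpos
      · exact hpos γ (by simp [hγ])
    · rw [← hsum]; simp only [Multiset.sum_cons]; abel

/-- A positive root together with an `sl₂`-triple on whose coroot a given nonzero weight does
not vanish. -/
lemma exists_sl2_pos {L : Module.Dual ℂ ↥C.h0} (hL : L ≠ 0) :
    ∃ α ∈ T.pos, ∃ k, ∃ e ∈ C.wtg k α, ∃ f ∈ C.wtg (-k) (-α),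
      ⁅e, f⁆ = (T.coroot α : P.g) ∧ L (T.coroot α) ≠ 0 := by
  by_contra! hcon
  have hpos : ∀ α ∈ T.pos, L (T.coroot α) = 0 := by
    intro α hα
    obtain ⟨k, e, he, f, hf, ht⟩ := T.exists_sl2 (T.pos_sub hα)
    exact hcon α hα k e he f hf ht.lie_e_f
  have hall : ∀ α ∈ C.Δen, L (T.coroot α) = 0 := by
    intro α hα
    rcases T.pos_total α hα with h | h
    · exact hpos α h
    · have := hpos _ h
      rwa [T.coroot_neg α hα, map_neg, neg_eq_zero] at this
  have := P.gfin
  let B : ↥C.h0 →ₗ[ℂ] Module.Dual ℂ ↥C.h0 :=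
    { toFun := fun x => (P.bil (x : P.g)).comp C.h0.subtype
      map_add' := fun x y => by ext; simp
      map_smul' := fun c x => by ext; simp }
  have hBinj : Function.Injective B := by
    rw [injective_iff_map_eq_zero]
    intro x hx
    exact Subtype.ext (T.bil_h0_nondeg x.2 fun y hy => LinearMap.congr_fun hx ⟨y, hy⟩)
  have hBsurj : Function.Surjective B :=
    (LinearMap.injective_iff_surjective_of_finrank_eq_finrank
      (Subspace.dual_finrank_eq).symm).mp hBinj
  obtain ⟨t, ht⟩ := hBsurj L
  have hzero : ∀ α ∈ C.Δen, α t = 0 := by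
    intro α hα
    have h1 := T.cnorm_spec α hα t
    have h2 : P.bil (t : P.g) (T.coroot α) = L (T.coroot α) := by rw [← ht]; rfl
    rw [P.bil_symm, h2, hall α hα] at h1
    exact (mul_eq_zero.mp h1.symm).resolve_left (T.cnorm_ne_zero hα)
  have hcentral : ∀ y : P.g, ⁅(t : P.g), y⁆ = 0 := by
    intro y
    have hle : (⨆ k, ⨆ α, C.wtg k α) ≤ LinearMap.ker (LieAlgebra.ad ℂ P.g (t : P.g)) := by
      refine iSup₂_le fun l β y hy => ?_
      rw [LinearMap.mem_ker, LieAlgebra.ad_apply, mem_wtfull.mp hy.2 t]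
      by_cases hy0 : y = 0
      · simp [hy0]
      by_cases hβ : β = 0
      · simp [hβ]
      · rw [hzero β ⟨hβ, l, fun h => hy0 (by rw [h] at hy; exact hy)⟩, zero_smul]
    rw [T.iSup_wtg] at hle
    exact hle (Submodule.mem_top (x := y))
  have ht0 : (t : P.g) = 0 := by
    have := P.gsimple
    have hc : (t : P.g) ∈ LieAlgebra.center ℂ P.g := by
      rw [LieModule.mem_maxTrivSubmodule]
      intro y
      rw [← lie_skew, hcentral, neg_zero]
    rw [LieAlgebra.center_eq_bot] at hc
    exact hc
  apply hL
  rw [← ht, show t = 0 from Subtype.ext ht0, map_zero]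

end Torus

namespace Toroidal

variable {P : PreT} {C : Cartan P} {T : Torus P C} (X : Toroidal P C T)

open PreT Cartan

lemma E_mem_tauP {α : Module.Dual ℂ ↥C.h0} (hα : α ∈ T.pos) {k : Fin P.n → ℤ} {x : P.g}
    (hx : x ∈ C.wtg k α) : X.E k x ∈ X.tauP := ⟨α, hα, k, x, hx, rfl⟩

lemma E_mem_tauZ {k : Fin P.n → ℤ} {x : P.g} (hx : x ∈ C.wtg k 0) : X.E k x ∈ X.tauZ :=
  Or.inl ⟨k, x, hx, rfl⟩

lemma h0_mem_wtg {r : Fin P.n → ℤ} (hr : P.inΓ r) {x : P.g} (hx : x ∈ C.h0) : x ∈ C.wtg r 0 :=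
  ⟨gr_of_inΓ hr ▸ C.h0_le hx, h0_le_wtfull hx⟩

lemma E_h0_mem_tauZ {r : Fin P.n → ℤ} (hr : P.inΓ r) {x : P.g} (hx : x ∈ C.h0) :
    X.E r x ∈ X.tauZ := X.E_mem_tauZ (h0_mem_wtg hr hx)

lemma K_mem_tauZ {r : Fin P.n → ℤ} (hr : P.inΓ r) (i : Fin P.n) : X.K r i ∈ X.tauZ :=
  Or.inr ⟨r, i, hr, Or.inl rfl⟩

lemma Dop_mem_tauZ {r : Fin P.n → ℤ} (hr : P.inΓ r) (i : Fin P.n) : X.Dop r i ∈ X.tauZ :=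
  Or.inr ⟨r, i, hr, Or.inr rfl⟩

lemma wtg_add_right {r : Fin P.n → ℤ} (hr : P.inΓ r) (k : Fin P.n → ℤ)
    (α : Module.Dual ℂ ↥C.h0) : C.wtg (k + r) α = C.wtg k α := by
  rw [wtg, gr_add_right hr, wtg]

lemma wtg_add_left {r : Fin P.n → ℤ} (hr : P.inΓ r) (k : Fin P.n → ℤ)
    (α : Module.Dual ℂ ↥C.h0) : C.wtg (r + k) α = C.wtg k α := by
  rw [add_comm, wtg_add_right hr]

lemma br_h_E (h : ↥C.h0) {k : Fin P.n → ℤ} {α : Module.Dual ℂ ↥C.h0} {x : P.g}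
    (hx : x ∈ C.wtg k α) : ⁅X.E 0 (h : P.g), X.E k x⁆ = α h • X.E k x := by
  rw [X.br_EE 0 k _ _ (C.h0_le h.2) hx.1, mem_wtfull.mp hx.2, zero_add, map_smul]
  simp

lemma br_d_K {s : Fin P.n → ℤ} (hs : P.inΓ s) (i j : Fin P.n) :
    ⁅X.Dop 0 i, X.K s j⁆ = (s i : ℂ) • X.K s j := by
  rw [X.br_DK 0 s inΓ_zero hs]; simp

lemma br_d_D {s : Fin P.n → ℤ} (hs : P.inΓ s) (i j : Fin P.n) :
    ⁅X.Dop 0 i, X.Dop s j⁆ = (s i : ℂ) • X.Dop s j := by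
  rw [X.br_DD 0 s inΓ_zero hs]; simp

lemma br_d_E {k : Fin P.n → ℤ} {x : P.g} (hx : x ∈ P.gr k) (i : Fin P.n) :
    ⁅X.Dop 0 i, X.E k x⁆ = (k i : ℂ) • X.E k x := by
  rw [X.br_DE 0 inΓ_zero i k x hx, zero_add]

/-- The bracket of an element of `τ̃₀` with a positive root vector of `τ̃` lies in `τ̃₊`. -/
lemma br_P_Z {α : Module.Dual ℂ ↥C.h0} (hα : α ∈ T.pos) {k : Fin P.n → ℤ} {x : P.g}
    (hx : x ∈ C.wtg k α) {z : X.τ} (hz : z ∈ X.tauZ) :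
    ∃ c : ℂ, ∃ p ∈ X.tauP, ⁅X.E k x, z⁆ = c • p := by
  rcases hz with ⟨l, y, hy, rfl⟩ | ⟨r, i, hr, rfl | rfl⟩
  · refine ⟨1, X.E (k + l) ⁅x, y⁆, X.E_mem_tauP hα ?_, ?_⟩
    · simpa using lie_mem_wtg hx hy
    · have : P.bil x y = 0 := by
        by_contra hne
        have := bil_wtfull hx.2 hy.2 hne
        rw [add_zero] at this
        exact (T.pos_sub hα).1 this
      rw [X.br_EE k l x y hx.1 hy.1, this]; simp
  · exact ⟨0, _, X.E_mem_tauP hα hx, by rw [X.br_EK k x hx.1]; simp⟩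
  · refine ⟨-(k i : ℂ), X.E (r + k) x, X.E_mem_tauP hα (by rwa [wtg_add_left hr]), ?_⟩
    rw [← lie_skew, X.br_DE r hr i k x hx.1, neg_smul]

end Toroidal

/-- A family of vectors that is triangular with respect to a family of linear maps is linearly
independent. -/
lemma linearIndependent_of_triangular {V : Type*} [AddCommGroup V] [Module ℂ V] (u : ℕ → V)
    (φ : ℕ → V →ₗ[ℂ] V) (h0 : ∀ m k, k < m → φ m (u k) = 0) (h1 : ∀ m, φ m (u m) ≠ 0) :
    LinearIndependent ℂ u := by
  classical
  rw [linearIndependent_iff']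
  intro s g hg
  by_contra! hcon
  obtain ⟨i, hi, hgi⟩ := hcon
  have hne : (s.filter fun j => g j ≠ 0).Nonempty := ⟨i, by simp [hi, hgi]⟩
  obtain ⟨m, hm, hmax⟩ := Finset.exists_max_image _ id hne
  rw [Finset.mem_filter] at hm
  have h2 := congrArg (φ m) hg
  rw [map_sum, map_zero, Finset.sum_eq_single m] at h2
  · rw [map_smul] at h2
    exact hm.2 ((smul_eq_zero.mp h2).resolve_right (h1 m))
  · intro k hk hkm
    rw [map_smul]
    rcases lt_or_gt_of_ne hkm with h | h
    · rw [h0 m k h, smul_zero]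
    · have : g k = 0 := by
        by_contra hgk
        exact absurd (hmax k (by simp [hk, hgk])) (not_le.mpr h)
      rw [this, zero_smul]
  · exact fun h => absurd hm.1 h

namespace TRep

variable {P : PreT} {C : Cartan P} {T : Torus P C} {X : Toroidal P C T} (M : TRep X)

open PreT Cartan Toroidal

lemma ρ_swap (a b : X.τ) (v : M.V) : M.ρ a (M.ρ b v) = M.ρ b (M.ρ a v) + M.ρ ⁅a, b⁆ v := by
  rw [M.ρ_lie]; simp

lemma commute_of_lie_eq_zero {a b : X.τ} (h : M.ρ ⁅a, b⁆ = 0) : Commute (M.ρ a) (M.ρ b) := by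
  rw [M.ρ_lie] at h
  exact sub_eq_zero.mp h

/-- The weight spaces for `𝔥_{0̄}`. -/
def hWt (μ : Module.Dual ℂ ↥C.h0) : Submodule ℂ M.V :=
  ⨅ h : ↥C.h0, LinearMap.ker (M.ρ (X.E 0 (h : P.g)) - μ h • (1 : Module.End ℂ M.V))

variable {M}

lemma mem_hWt {μ : Module.Dual ℂ ↥C.h0} {v : M.V} :
    v ∈ M.hWt μ ↔ ∀ h : ↥C.h0, M.ρ (X.E 0 (h : P.g)) v = μ h • v := by
  simp only [hWt, Submodule.mem_iInf, LinearMap.mem_ker, LinearMap.sub_apply, sub_eq_zero]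
  rfl

lemma mem_dEig {b : Fin P.n → ℂ} {v : M.V} :
    v ∈ M.dEig b ↔ ∀ i, M.ρ (X.Dop 0 i) v = b i • v := by
  simp only [dEig, Submodule.mem_iInf, LinearMap.mem_ker, LinearMap.sub_apply, sub_eq_zero]
  rfl

lemma mem_wtSp {w : C.Wt} {v : M.V} :
    v ∈ M.wtSp w ↔ v ∈ M.hWt w.1 ∧ (∀ i, M.ρ (X.K 0 i) v = w.2.1 i • v) ∧ v ∈ M.dEig w.2.2 := by
  have : M.wtSp w = (M.hWt w.1 ⊓ ⨅ i, LinearMap.ker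
      (M.ρ (X.K 0 i) - w.2.1 i • (1 : Module.End ℂ M.V))) ⊓ M.dEig w.2.2 := rfl
  rw [this, Submodule.mem_inf, Submodule.mem_inf, and_assoc]
  simp only [Submodule.mem_iInf, LinearMap.mem_ker, LinearMap.sub_apply, sub_eq_zero]
  rfl

lemma mem_Vplus {v : M.V} : v ∈ M.Vplus ↔ ∀ t ∈ X.tauP, M.ρ t v = 0 := by
  simp only [Vplus, Submodule.mem_iInf, LinearMap.mem_ker]

lemma E_hWt {k : Fin P.n → ℤ} {α μ : Module.Dual ℂ ↥C.h0} {x : P.g} (hx : x ∈ C.wtg k α)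
    {v : M.V} (hv : v ∈ M.hWt μ) : M.ρ (X.E k x) v ∈ M.hWt (μ + α) := by
  rw [mem_hWt] at *
  intro h
  rw [M.ρ_swap, X.br_h_E h hx, hv, map_smul, map_smul, LinearMap.smul_apply, ← add_smul]
  rfl

/-- An element of degree `k` shifts degrees by `k`. -/
lemma dEig_of_br {t : X.τ} {k : Fin P.n → ℤ} (ht : ∀ i, ⁅X.Dop 0 i, t⁆ = (k i : ℂ) • t)
    {b : Fin P.n → ℂ} {v : M.V} (hv : v ∈ M.dEig b) :
    M.ρ t v ∈ M.dEig (fun i => b i + (k i : ℂ)) := by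
  rw [mem_dEig] at *
  intro i
  rw [M.ρ_swap, ht, hv, map_smul, map_smul, LinearMap.smul_apply, ← add_smul]

lemma tauZ_Vplus {t : X.τ} (ht : t ∈ X.tauZ) {v : M.V} (hv : v ∈ M.Vplus) :
    M.ρ t v ∈ M.Vplus := by
  rw [mem_Vplus] at *
  rintro _ ⟨α, hα, k, x, hx, rfl⟩
  obtain ⟨c, p, hp, hbr⟩ := X.br_P_Z hα hx ht
  rw [M.ρ_swap, hbr, hv _ (X.E_mem_tauP hα hx), map_smul, LinearMap.smul_apply, hv p hp]
  simp

lemma VplusGr_of_br {Λ : C.Wt} {t : X.τ} (htZ : t ∈ X.tauZ) {k a : Fin P.n → ℤ}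
    (ht : ∀ i, ⁅X.Dop 0 i, t⁆ = (k i : ℂ) • t) {v : M.V} (hv : v ∈ M.VplusGr Λ a) :
    M.ρ t v ∈ M.VplusGr Λ (a + k) := by
  refine ⟨tauZ_Vplus htZ hv.1, ?_⟩
  have := dEig_of_br ht hv.2
  simpa [add_assoc] using this

lemma E_VplusGr {Λ : C.Wt} {r a : Fin P.n → ℤ} (hr : P.inΓ r) {h : P.g} (hh : h ∈ C.h0)
    {v : M.V} (hv : v ∈ M.VplusGr Λ a) : M.ρ (X.E r h) v ∈ M.VplusGr Λ (a + r) :=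
  VplusGr_of_br (X.E_h0_mem_tauZ hr hh) (X.br_d_E (h0_mem_wtg hr hh).1) hv

lemma K_VplusGr {Λ : C.Wt} {r a : Fin P.n → ℤ} (hr : P.inΓ r) (i : Fin P.n)
    {v : M.V} (hv : v ∈ M.VplusGr Λ a) : M.ρ (X.K r i) v ∈ M.VplusGr Λ (a + r) :=
  VplusGr_of_br (X.K_mem_tauZ hr i) (fun j => X.br_d_K hr j i) hv

lemma Dop_VplusGr {Λ : C.Wt} {r a : Fin P.n → ℤ} (hr : P.inΓ r) (i : Fin P.n)
    {v : M.V} (hv : v ∈ M.VplusGr Λ a) : M.ρ (X.Dop r i) v ∈ M.VplusGr Λ (a + r) :=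
  VplusGr_of_br (X.Dop_mem_tauZ hr i) (fun j => X.br_d_D hr j i) hv

section LevelZero

variable (hK0 : ∀ i, M.ρ (X.K 0 i) = 0)
include hK0

/-- `Σᵢ rᵢ t^{jr} Kᵢ` acts trivially on a level zero module. -/
lemma sum_K_multiple {r : Fin P.n → ℤ} (hr : P.inΓ r) (j : ℤ) :
    M.ρ (∑ i, (r i : ℂ) • X.K (j • r) i) = 0 := by
  by_cases hj : j = 0
  · simp [hj, hK0]
  · have h1 := X.K_dA (j • r) (inΓ_zsmul j hr)
    have h2 : (j : ℂ) • ∑ i, (r i : ℂ) • X.K (j • r) i = 0 := by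
      rw [← h1, Finset.smul_sum]
      refine Finset.sum_congr rfl fun i _ => ?_
      rw [smul_smul, Pi.smul_apply, smul_eq_mul, Int.cast_mul]
    rw [(smul_eq_zero.mp h2).resolve_left (by exact_mod_cast hj), map_zero]

lemma commute_E_multiple {r : Fin P.n → ℤ} (hr : P.inΓ r) (j : ℤ) {x y : P.g} (hx : x ∈ C.h0)
    (hy : y ∈ C.h0) : Commute (M.ρ (X.E r x)) (M.ρ (X.E (j • r) y)) := by
  apply M.commute_of_lie_eq_zero
  rw [X.br_EE r (j • r) x y (h0_mem_wtg hr hx).1 (h0_mem_wtg (inΓ_zsmul j hr) hy).1,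
    C.h0_abelian x hx y hy, map_zero, zero_add, map_smul]
  have : r + j • r = (j + 1) • r := by rw [add_smul, one_smul, add_comm]
  rw [this, sum_K_multiple hK0 hr, smul_zero]

end LevelZero

lemma VplusGr_le_wtSp (hK0 : ∀ i, M.ρ (X.K 0 i) = 0) {Λ : C.Wt}
    (hact : ∀ h : ↥C.h0, ∀ v ∈ M.Vplus, M.ρ (X.E 0 (h : P.g)) v = Λ.1 h • v)
    (a : Fin P.n → ℤ) :
    M.VplusGr Λ a ≤ M.wtSp (Λ.1, 0, fun i => Λ.2.2 i + (a i : ℂ)) := fun v hv =>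
  mem_wtSp.mpr ⟨mem_hWt.mpr fun h => hact h v hv.1, fun i => by simp [hK0], hv.2⟩

/-- On the highest weight space, the operators `h₀ ⊗ t^r` are injective on homogeneous
vectors. -/
lemma E_injective (hfin : M.FinWt) (hK0 : ∀ i, M.ρ (X.K 0 i) = 0)
    {Λ : C.Wt} (hΛ0 : Λ.1 ≠ 0)
    (hact : ∀ h : ↥C.h0, ∀ v ∈ M.Vplus, M.ρ (X.E 0 (h : P.g)) v = Λ.1 h • v)
    {h₀ : ↥C.h0} (hh₀ : Λ.1 h₀ ≠ 0) {r : Fin P.n → ℤ} (hr : P.inΓ r) {a : Fin P.n → ℤ}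
    {w : M.V} (hw : w ∈ M.VplusGr Λ a) (hzero : M.ρ (X.E r (h₀ : P.g)) w = 0) : w = 0 := by
  by_contra hw0
  by_cases hr0 : r = 0
  · subst hr0
    rw [hact h₀ w hw.1] at hzero
    exact (smul_eq_zero.mp hzero).elim hh₀ hw0
  obtain ⟨l, hl⟩ : ∃ l, r l ≠ 0 := Function.ne_iff.mp hr0
  obtain ⟨α, hα, k₀, e, he, f, hf, hef, hL⟩ := T.exists_sl2_pos hΛ0
  set D := M.ρ (X.Dop (-r) l) with hD
  set H := M.ρ (X.E r (h₀ : P.g)) with hH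
  have hDmem : ∀ k : ℕ, (D ^ k) w ∈ M.VplusGr Λ (a + k • (-r)) := by
    intro k
    induction k with
    | zero => simpa using hw
    | succ k ih =>
      rw [pow_succ', Module.End.mul_apply, succ_nsmul, ← add_assoc]
      exact Dop_VplusGr (inΓ_neg hr) l ih
  have hHD : ∀ v ∈ M.Vplus, H (D v) = D (H v) + (-((r l : ℂ) * Λ.1 h₀)) • v := by
    intro v hv
    rw [hH, hD, M.ρ_swap, ← lie_skew, X.br_DE (-r) (inΓ_neg hr) l r _ (h0_mem_wtg hr h₀.2).1,
      neg_add_cancel, map_neg, map_smul, LinearMap.neg_apply, LinearMap.smul_apply, hact h₀ v hv,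
      smul_smul, neg_smul]
  set c : ℂ := -((r l : ℂ) * Λ.1 h₀) with hc
  have hc0 : c ≠ 0 := neg_ne_zero.mpr (mul_ne_zero (by exact_mod_cast hl) hh₀)
  have hHDk : ∀ k : ℕ, H ((D ^ (k + 1)) w) = (((k : ℂ) + 1) * c) • (D ^ k) w := by
    intro k
    induction k with
    | zero =>
      rw [zero_add, pow_one, hHD w hw.1, hzero]; simp
    | succ k ih =>
      rw [pow_succ', Module.End.mul_apply, hHD _ (hDmem (k + 1)).1, ih, map_smul,
        ← Module.End.mul_apply, ← pow_succ', ← add_smul]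
      congr 1; push_cast; ring
  have hHlt : ∀ m k : ℕ, k < m → (H ^ m) ((D ^ k) w) = 0 := by
    intro m
    induction m with
    | zero => intro k hk; omega
    | succ m ih =>
      intro k hk
      rw [pow_succ, Module.End.mul_apply]
      rcases k with _ | k
      · rw [pow_zero, Module.End.one_apply, hzero, map_zero]
      · rw [hHDk, map_smul, ih k (by omega), smul_zero]
  have hHeq : ∀ m : ℕ, ∃ d : ℂ, d ≠ 0 ∧ (H ^ m) ((D ^ m) w) = d • w := by
    intro m
    induction m with
    | zero => exact ⟨1, one_ne_zero, by simp⟩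
    | succ m ih =>
      obtain ⟨d, hd, hd'⟩ := ih
      refine ⟨(((m : ℂ) + 1) * c) * d, mul_ne_zero (mul_ne_zero (by exact_mod_cast m.succ_ne_zero)
        hc0) hd, ?_⟩
      rw [pow_succ H, Module.End.mul_apply, hHDk, map_smul, hd', smul_smul]
  have hfk : ∀ k : ℕ, f ∈ C.wtg (-k₀ + k • r) (-α) := fun k => by
    rwa [wtg_add_right (inΓ_nsmul k hr)]
  have hek : ∀ m : ℕ, e ∈ C.wtg (k₀ + m • (-r)) α := fun m => by
    rwa [wtg_add_right (inΓ_nsmul m (inΓ_neg hr))]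
  have hef0 : ⁅e, f⁆ ∈ C.h0 := hef ▸ (T.coroot α).2
  set u : ℕ → M.V := fun k => M.ρ (X.E (-k₀ + k • r) f) ((D ^ k) w) with hu
  have hZ : ∀ m k : ℕ, ⁅X.E (k₀ + m • (-r)) e, X.E (-k₀ + k • r) f⁆ =
      X.E (((k : ℤ) - m) • r) ⁅e, f⁆ + P.bil e f • ∑ i, ((k₀ + m • (-r)) i : ℂ) •
        X.K (((k : ℤ) - m) • r) i := by
    intro m k
    have : (k₀ + m • (-r)) + (-k₀ + k • r) = ((k : ℤ) - m) • r := by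
      rw [sub_smul, natCast_zsmul, natCast_zsmul, smul_neg]; abel
    rw [X.br_EE _ _ _ _ (hek m).1 (hfk k).1, this]
  have hcomm : ∀ m k : ℕ, Commute (H ^ m)
      (M.ρ ⁅X.E (k₀ + m • (-r)) e, X.E (-k₀ + k • r) f⁆) := by
    intro m k
    apply Commute.pow_left
    rw [hZ, map_add, map_smul, map_sum]
    refine (commute_E_multiple hK0 hr _ h₀.2 hef0).add_right ((Commute.sum_right _ _ _
      fun i _ => ?_).smul_right _)
    rw [map_smul]
    refine Commute.smul_right (M.commute_of_lie_eq_zero ?_) _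
    rw [X.br_EK r _ (h0_mem_wtg hr h₀.2).1, map_zero]
  have hφ : ∀ m k : ℕ, (H ^ m * M.ρ (X.E (k₀ + m • (-r)) e)) (u k) =
      M.ρ ⁅X.E (k₀ + m • (-r)) e, X.E (-k₀ + k • r) f⁆ ((H ^ m) ((D ^ k) w)) := by
    intro m k
    rw [Module.End.mul_apply, hu, M.ρ_swap, mem_Vplus.mp (hDmem k).1 _ (X.E_mem_tauP hα (hek m)),
      map_zero, zero_add, ← Module.End.mul_apply, (hcomm m k).eq, Module.End.mul_apply]
  have hli : LinearIndependent ℂ u := by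
    refine linearIndependent_of_triangular u
      (fun m => H ^ m * M.ρ (X.E (k₀ + m • (-r)) e)) (fun m k hk => ?_) fun m => ?_
    · rw [hφ, hHlt m k hk, map_zero]
    · obtain ⟨d, hd, hd'⟩ := hHeq m
      rw [hφ, hd', map_smul, hZ]
      simp only [sub_self, zero_smul, map_add, map_smul, map_sum, hK0, smul_zero,
        Finset.sum_const_zero, add_zero]
      rw [hef, hact _ w hw.1]
      exact smul_ne_zero hd (smul_ne_zero hL hw0)
  set W := M.wtSp (Λ.1 + -α, 0, fun i => Λ.2.2 i + ((a + -k₀) i : ℂ)) with hW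
  have huW : ∀ k, u k ∈ W := by
    intro k
    refine mem_wtSp.mpr ⟨E_hWt (hfk k) (mem_hWt.mpr fun h => hact h _ (hDmem k).1),
      fun i => by simp [hK0], ?_⟩
    have := dEig_of_br (X.br_d_E (hfk k).1) (hDmem k).2
    convert this using 2
    funext i
    simp only [Pi.add_apply, Pi.neg_apply, Pi.smul_apply]
    simp only [nsmul_eq_mul]
    push_cast
    ring
  have := hfin (Λ.1 + -α, 0, fun i => Λ.2.2 i + ((a + -k₀) i : ℂ))
  have hli' : LinearIndependent ℂ fun k => (⟨u k, huW k⟩ : ↥W) :=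
    LinearIndependent.of_comp W.subtype hli
  exact not_finite_iff_infinite.mpr inferInstance hli'.finite

end TRep

namespace TRep

variable {P : PreT} {C : Cartan P} {T : Torus P C} {X : Toroidal P C T} {M : TRep X}

open PreT Cartan Toroidal

/-- A subspace stable under the homogeneous generators is a submodule. -/
lemma stable_of_generators {U Y : Submodule ℂ M.V}
    (hE : ∀ k, ∀ x ∈ P.gr k, ∀ v ∈ U, M.ρ (X.E k x) v ∈ Y)
    (hK : ∀ r, P.inΓ r → ∀ i, ∀ v ∈ U, M.ρ (X.K r i) v ∈ Y)
    (hD : ∀ r, P.inΓ r → ∀ i, ∀ v ∈ U, M.ρ (X.Dop r i) v ∈ Y)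
    (t : X.τ) {v : M.V} (hv : v ∈ U) : M.ρ t v ∈ Y := by
  have ht : t ∈ Submodule.span ℂ
    ({t | ∃ k x, x ∈ P.gr k ∧ t = X.E k x} ∪ {t | ∃ r i, P.inΓ r ∧ t = X.K r i} ∪
      {t | ∃ r i, P.inΓ r ∧ t = X.Dop r i}) := by rw [X.span_top]; trivial
  induction ht using Submodule.span_induction with
  | mem t ht =>
    rcases ht with (⟨k, x, hx, rfl⟩ | ⟨r, i, hr, rfl⟩) | ⟨r, i, hr, rfl⟩
    · exact hE k x hx v hv
    · exact hK r hr i v hv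
    · exact hD r hr i v hv
  | zero => simp
  | add a b _ _ ha hb => rw [map_add]; exact Y.add_mem ha hb
  | smul c a _ ha => rw [map_smul]; exact Y.smul_mem c ha

/-- The triangular decomposition: it suffices to check the three types of generators. -/
lemma stable_of_triangular {U Y : Submodule ℂ M.V}
    (hM : ∀ t ∈ X.tauM, ∀ v ∈ U, M.ρ t v ∈ Y) (hZ : ∀ t ∈ X.tauZ, ∀ v ∈ U, M.ρ t v ∈ Y)
    (hP : ∀ t ∈ X.tauP, ∀ v ∈ U, M.ρ t v ∈ Y) (t : X.τ) {v : M.V} (hv : v ∈ U) :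
    M.ρ t v ∈ Y := by
  refine stable_of_generators (fun k x hx v hv => ?_)
    (fun r hr i v hv => hZ _ (X.K_mem_tauZ hr i) v hv)
    (fun r hr i v hv => hZ _ (X.Dop_mem_tauZ hr i) v hv) t hv
  let F : P.g →ₗ[ℂ] M.V := (LinearMap.applyₗ v).comp (M.ρ.comp (X.E k))
  have hle : (⨆ α, C.wtg k α) ≤ Y.comap F := by
    refine iSup_le fun α y hy => ?_
    change M.ρ (X.E k y) v ∈ Y
    by_cases hα : α = 0
    · subst hα
      exact hZ _ (X.E_mem_tauZ hy) v hv
    by_cases hy0 : y = 0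
    · rw [hy0]; simp
    have hΔ : α ∈ C.Δen := ⟨hα, k, fun h => hy0 (by rw [h] at hy; exact hy)⟩
    rcases T.pos_total α hΔ with h | h
    · exact hP _ ⟨α, h, k, y, hy, rfl⟩ v hv
    · exact hM _ ⟨α, h, k, y, hy, rfl⟩ v hv
  exact hle (T.gr_le_iSup_wtg k hx)

lemma hWt_eq_zero_of_mem_iSup {μ₀ : Module.Dual ℂ ↥C.h0} {v : M.V} (hv : v ∈ M.hWt μ₀)
    (hv' : v ∈ ⨆ μ : {μ : Module.Dual ℂ ↥C.h0 // μ ≠ μ₀}, M.hWt μ) : v = 0 := by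
  obtain ⟨s, y, hy, rfl⟩ := exists_sum_of_mem_iSup _ hv'
  refine Finset.sum_eq_zero fun μ hμ => ?_
  obtain ⟨h, hh⟩ : ∃ h, (μ : Module.Dual ℂ ↥C.h0) h ≠ μ₀ h := by
    by_contra! hcon
    exact μ.2 (LinearMap.ext hcon)
  have key := joint_eigen_sum_eq_zero (fun h : ↥C.h0 => M.ρ (X.E 0 (h : P.g)))
    (fun (μ : {μ : Module.Dual ℂ ↥C.h0 // μ ≠ μ₀}) h => (μ : Module.Dual ℂ ↥C.h0) h)
    (fun a b hab => Subtype.ext (DFunLike.coe_injective hab)) s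
    (fun μ => ((μ : Module.Dual ℂ ↥C.h0) h - μ₀ h) • y μ)
    (fun μ _ h' => mem_hWt.mp (Submodule.smul_mem _ _ (hy μ)) h') ?_ μ hμ
  · exact (smul_eq_zero.mp key).resolve_left (sub_ne_zero.mpr hh)
  · have h1 := mem_hWt.mp hv h
    rw [map_sum, Finset.smul_sum] at h1
    rw [← sub_eq_zero, ← Finset.sum_sub_distrib] at h1
    rw [← h1]
    refine Finset.sum_congr rfl fun μ _ => ?_
    rw [mem_hWt.mp (hy μ) h, sub_smul]

/-- A nonzero `τ̃₀`-submodule of the highest weight space of an irreducible module contains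
every vector of highest `𝔥_{0̄}`-weight. -/
lemma mem_of_mem_hWt (hirr : M.Irr) {Λ : C.Wt}
    (hact : ∀ h : ↥C.h0, ∀ v ∈ M.Vplus, M.ρ (X.E 0 (h : P.g)) v = Λ.1 h • v)
    {U : Submodule ℂ M.V} (hUV : U ≤ M.Vplus) (hU : U ≠ ⊥)
    (hZ : ∀ t ∈ X.tauZ, ∀ v ∈ U, M.ρ t v ∈ U) {v : M.V} (hv : v ∈ M.hWt Λ.1) : v ∈ U := by
  let Y : Submodule ℂ M.V := sInf {Y | U ≤ Y ∧ ∀ t ∈ X.tauM, ∀ v ∈ Y, M.ρ t v ∈ Y}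
  have hUY : U ≤ Y := le_sInf fun Y hY => hY.1
  have hYle : ∀ Y' : Submodule ℂ M.V, U ≤ Y' → (∀ t ∈ X.tauM, ∀ v ∈ Y', M.ρ t v ∈ Y') → Y ≤ Y' :=
    fun Y' h1 h2 => sInf_le ⟨h1, h2⟩
  have hYM : ∀ t ∈ X.tauM, ∀ v ∈ Y, M.ρ t v ∈ Y := by
    intro t ht v hv
    rw [Submodule.mem_sInf] at *
    exact fun Y' hY' => hY'.2 t ht v (hv Y' hY')
  let N : Submodule ℂ M.V :=
    { carrier := {v | v ∈ Y ∧ ∀ t : X.τ, M.ρ t v ∈ Y}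
      add_mem' := fun {a b} ha hb => ⟨Y.add_mem ha.1 hb.1, fun t => by
        rw [map_add]; exact Y.add_mem (ha.2 t) (hb.2 t)⟩
      zero_mem' := ⟨Y.zero_mem, fun t => by rw [map_zero]; exact Y.zero_mem⟩
      smul_mem' := fun c a ha => ⟨Y.smul_mem c ha.1, fun t => by
        rw [map_smul]; exact Y.smul_mem c (ha.2 t)⟩ }
  have hYN : Y ≤ N := by
    refine hYle N (fun u hu => ⟨hUY hu, fun t => ?_⟩) fun t ht v hv => ⟨hYM t ht v hv.1, fun z => ?_⟩
    · exact stable_of_triangular (U := U) (fun t ht v hv => hYM t ht v (hUY hv))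
        (fun t ht v hv => hUY (hZ t ht v hv))
        (fun t ht v hv => by rw [mem_Vplus.mp (hUV hv) t ht]; exact Y.zero_mem) t hu
    · rw [M.ρ_swap]
      exact Y.add_mem (hYM t ht _ (hv.2 z)) (hv.2 _)
  have hYtop : Y = ⊤ := (hirr.2 Y fun t v hv => (hYN hv).2 t).resolve_left fun h => hU
    (eq_bot_iff.mpr (h ▸ hUY))
  let V' : Submodule ℂ M.V := ⨆ s : {s : Multiset (Module.Dual ℂ ↥C.h0) //
    s ≠ 0 ∧ ∀ α ∈ s, α ∈ T.pos}, M.hWt (Λ.1 - s.1.sum)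
  have hYV : Y ≤ U ⊔ V' := by
    refine hYle _ le_sup_left ?_
    rintro _ ⟨α, hα, k, x, hx, rfl⟩ v hv
    have hle : U ⊔ V' ≤ (U ⊔ V').comap (M.ρ (X.E k x)) := by
      refine sup_le (fun u hu => ?_) (iSup_le fun s u hu => ?_)
      · refine (le_sup_right : V' ≤ U ⊔ V') (Submodule.mem_iSup_of_mem
          ⟨{-α}, by simp, by simpa using hα⟩ ?_)
        have := E_hWt (μ := Λ.1) hx (mem_hWt.mpr fun h => hact h u (hUV hu))
        simpa using this
      · refine (le_sup_right : V' ≤ U ⊔ V') (Submodule.mem_iSup_of_mem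
          ⟨(-α) ::ₘ s.1, by simp, fun β hβ => ?_⟩ ?_)
        · rcases Multiset.mem_cons.mp hβ with rfl | hβ
          · exact hα
          · exact s.2.2 β hβ
        · have := E_hWt hx hu
          convert this using 2
          rw [Multiset.sum_cons]; abel
    exact hle hv
  obtain ⟨u, hu, v', hv', rfl⟩ := Submodule.mem_sup.mp (hYV (hYtop ▸ Submodule.mem_top : v ∈ Y))
  have h1 : v' ∈ M.hWt Λ.1 := by
    have := Submodule.sub_mem _ hv (mem_hWt.mpr fun h => hact h u (hUV hu))
    simpa using this
  have h2 : v' = 0 := by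
    refine hWt_eq_zero_of_mem_iSup h1 ?_
    refine SetLike.le_def.mp (iSup_le fun s => ?_) hv'
    have hs : Λ.1 - s.1.sum ≠ Λ.1 := by
      intro h
      obtain ⟨n, hn⟩ := Nat.exists_eq_succ_of_ne_zero
        (fun h => s.2.1 (Multiset.card_eq_zero.mp h))
      exact T.sum_pos_ne_zero n s.1 hn s.2.2 (by simpa using h)
    exact le_iSup (fun μ : {μ : Module.Dual ℂ ↥C.h0 // μ ≠ Λ.1} => M.hWt μ) ⟨_, hs⟩
  rw [h2, add_zero]
  exact hu

/-- The highest weight space of an irreducible module is irreducible over `τ̃₀`. -/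
lemma eq_Vplus_of_stable (hirr : M.Irr) {Λ : C.Wt}
    (hact : ∀ h : ↥C.h0, ∀ v ∈ M.Vplus, M.ρ (X.E 0 (h : P.g)) v = Λ.1 h • v)
    {U : Submodule ℂ M.V} (hUV : U ≤ M.Vplus) (hU : U ≠ ⊥)
    (hZ : ∀ t ∈ X.tauZ, ∀ v ∈ U, M.ρ t v ∈ U) : M.Vplus ≤ U := fun _ hv =>
  mem_of_mem_hWt hirr hact hUV hU hZ (mem_hWt.mpr fun h => hact h _ hv)

lemma VplusGr_zero_ne_bot (hirr : M.Irr) (hhw : M.IsHW) {Λ : C.Wt} (hΛ : Λ ∈ M.wts)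
    (hact : ∀ h : ↥C.h0, ∀ v ∈ M.Vplus, M.ρ (X.E 0 (h : P.g)) v = Λ.1 h • v) :
    M.VplusGr Λ 0 ≠ ⊥ := by
  obtain ⟨v, hv0, -, -, hvP, -⟩ := hhw
  obtain ⟨w, hw, hw0⟩ := Submodule.exists_mem_ne_zero_of_ne_bot (p := M.wtSp Λ) hΛ
  rw [mem_wtSp] at hw
  have hV : M.Vplus ≠ ⊥ := fun h => hv0 (by
    have := mem_Vplus.mpr hvP
    rw [h] at this
    exact this)
  have h1 : w ∈ M.Vplus := mem_of_mem_hWt hirr hact le_rfl hV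
    (fun t ht v hv => tauZ_Vplus ht hv) hw.1
  refine (Submodule.ne_bot_iff _).mpr ⟨w, ⟨h1, ?_⟩, hw0⟩
  simpa using hw.2.2

lemma VplusGr_finite (hfin : M.FinWt) (hK0 : ∀ i, M.ρ (X.K 0 i) = 0) {Λ : C.Wt}
    (hact : ∀ h : ↥C.h0, ∀ v ∈ M.Vplus, M.ρ (X.E 0 (h : P.g)) v = Λ.1 h • v)
    (a : Fin P.n → ℤ) : FiniteDimensional ℂ ↥(M.VplusGr Λ a) := by
  have := hfin (Λ.1, 0, fun i => Λ.2.2 i + (a i : ℂ))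
  exact Submodule.finiteDimensional_of_le (VplusGr_le_wtSp hK0 hact a)

lemma finrank_VplusGr (hfin : M.FinWt) (hK0 : ∀ i, M.ρ (X.K 0 i) = 0)
    {Λ : C.Wt} (hΛ0 : Λ.1 ≠ 0)
    (hact : ∀ h : ↥C.h0, ∀ v ∈ M.Vplus, M.ρ (X.E 0 (h : P.g)) v = Λ.1 h • v)
    {h₀ : ↥C.h0} (hh₀ : Λ.1 h₀ ≠ 0) {r : Fin P.n → ℤ} (hr : P.inΓ r) (a : Fin P.n → ℤ) :
    Module.finrank ℂ ↥(M.VplusGr Λ (a + r)) = Module.finrank ℂ ↥(M.VplusGr Λ a) := by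
  have hle : ∀ (r a : Fin P.n → ℤ), P.inΓ r →
      Module.finrank ℂ ↥(M.VplusGr Λ a) ≤ Module.finrank ℂ ↥(M.VplusGr Λ (a + r)) := by
    intro r a hr
    have := VplusGr_finite hfin hK0 hact (a + r)
    refine LinearMap.finrank_le_finrank_of_injective (f := (M.ρ (X.E r (h₀ : P.g))).restrict
      (p := M.VplusGr Λ a) (q := M.VplusGr Λ (a + r)) fun v hv => E_VplusGr hr h₀.2 hv) ?_
    rw [injective_iff_map_eq_zero]
    intro w hw
    exact Subtype.ext (E_injective hfin hK0 hΛ0 hact hh₀ hr w.2 (congrArg Subtype.val hw))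
  refine le_antisymm ?_ (hle r a hr)
  have := hle (-r) (a + r) (inΓ_neg hr)
  rwa [add_neg_cancel_right] at this

/-- `[t^r dᵢ, t^s Kⱼ]` is central. -/
lemma commute_K_br_DK {r s : Fin P.n → ℤ} (hr : P.inΓ r) (hs : P.inΓ s) (i j : Fin P.n)
    (s' : Fin P.n → ℤ) (j' : Fin P.n) :
    Commute (M.ρ (X.K s' j')) (M.ρ ⁅X.Dop r i, X.K s j⁆) := by
  have hKK : ∀ a b : Fin P.n → ℤ, ∀ i j, Commute (M.ρ (X.K a i)) (M.ρ (X.K b j)) :=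
    fun a b i j => M.commute_of_lie_eq_zero (by rw [X.br_KK, map_zero])
  rw [X.br_DK r s hr hs]
  simp only [map_add, map_smul, map_sum]
  exact ((hKK _ _ _ _).smul_right _).add_right ((Commute.sum_right _ _ _
    fun p _ => (hKK _ _ _ _).smul_right _).smul_right _)

/-- On an irreducible module each `t^s Kᵢ` is either injective or locally nilpotent. -/
lemma K_injective_or_nilpotent (hirr : M.Irr) {s : Fin P.n → ℤ} (hs : P.inΓ s) (j : Fin P.n) :
    (∀ v, M.ρ (X.K s j) v = 0 → v = 0) ∨ ∀ v, ∃ p : ℕ, (M.ρ (X.K s j) ^ p) v = 0 := by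
  set F := M.ρ (X.K s j) with hF
  have mono : ∀ {p q : ℕ} {v : M.V}, p ≤ q → (F ^ p) v = 0 → (F ^ q) v = 0 := by
    intro p q v hpq hv
    rw [← Nat.sub_add_cancel hpq, pow_add, Module.End.mul_apply, hv, map_zero]
  let U : Submodule ℂ M.V :=
    { carrier := {v | ∃ p : ℕ, (F ^ p) v = 0}
      add_mem' := by
        rintro a b ⟨p, hp⟩ ⟨q, hq⟩
        exact ⟨max p q, by rw [map_add, mono (le_max_left p q) hp, mono (le_max_right p q) hq,
          add_zero]⟩
      zero_mem' := ⟨0, by simp⟩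
      smul_mem' := by
        rintro c a ⟨p, hp⟩
        exact ⟨p, by rw [map_smul, hp, smul_zero]⟩ }
  have hcomm : ∀ G : Module.End ℂ M.V, Commute F G → ∀ v ∈ U, G v ∈ U := by
    rintro G hG v ⟨p, hp⟩
    refine ⟨p, ?_⟩
    rw [← Module.End.mul_apply, (hG.pow_left p).eq, Module.End.mul_apply, hp, map_zero]
  have hstab := stable_of_generators (M := M) (U := U) (Y := U)
    (fun k x hx => hcomm _ (M.commute_of_lie_eq_zero (by
      rw [← lie_skew, X.br_EK k x hx, neg_zero, map_zero])))
    (fun r _ i => hcomm _ (M.commute_of_lie_eq_zero (by rw [X.br_KK, map_zero])))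
    (fun r hr i v hv => by
      obtain ⟨p, hp⟩ := hv
      set G := M.ρ ⁅X.Dop r i, X.K s j⁆ with hG
      have hFG : Commute F G := commute_K_br_DK hr hs i j s j
      have hGD : G = M.ρ (X.Dop r i) * F - F * M.ρ (X.Dop r i) := by rw [hG, M.ρ_lie]
      have hpow : ∀ q : ℕ, F ^ (q + 1) * M.ρ (X.Dop r i) =
          M.ρ (X.Dop r i) * F ^ (q + 1) - ((q : ℂ) + 1) • (G * F ^ q) := by
        intro q
        induction q with
        | zero => rw [hGD]; simp
        | succ q ih =>
          have h1 : F * M.ρ (X.Dop r i) = M.ρ (X.Dop r i) * F - G := by rw [hGD]; abel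
          rw [pow_succ' F (q + 1), mul_assoc, ih, mul_sub, ← mul_assoc, h1, sub_mul, mul_assoc,
            ← pow_succ' F (q + 1), mul_smul_comm, ← mul_assoc, hFG.eq, mul_assoc, ← pow_succ' F q]
          push_cast
          module
      refine ⟨p + 1, ?_⟩
      rw [← Module.End.mul_apply, hpow, LinearMap.sub_apply, LinearMap.smul_apply,
        Module.End.mul_apply, Module.End.mul_apply, hp, mono (Nat.le_succ p) hp]
      simp)
  rcases hirr.2 U (fun t v hv => hstab t hv) with h | h
  · left
    intro v hv
    have : v ∈ U := ⟨1, by simpa using hv⟩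
    rw [h] at this
    exact this
  · right
    intro v
    exact (h ▸ Submodule.mem_top : v ∈ U)

end TRep

/-- A commutator `AB - BA` of endomorphisms of a finite-dimensional space which commutes with `B`
is nilpotent. -/
lemma isNilpotent_commutator_of_commute {W : Type*} [AddCommGroup W] [Module ℂ W]
    [FiniteDimensional ℂ W] {A B : Module.End ℂ W} (h : Commute (A * B - B * A) B) :
    IsNilpotent (A * B - B * A) := by
  set N := A * B - B * A with hN
  have htr : ∀ q : Polynomial ℂ,
      LinearMap.trace ℂ W (Polynomial.aeval N (q * Polynomial.X)) = 0 := by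
    intro q
    set Q := Polynomial.aeval N q with hQ
    have hQB : Commute Q B := by
      rw [hQ, Polynomial.aeval_eq_sum_range]
      exact Commute.sum_left _ _ _ fun i _ => (h.pow_left i).smul_left _
    rw [map_mul, Polynomial.aeval_X, hN, mul_sub, map_sub, ← mul_assoc, ← mul_assoc, hQB.eq,
      LinearMap.trace_mul_comm ℂ (Q * A) B, mul_assoc B Q A, sub_self]
  obtain ⟨q, hq, hqX⟩ := Polynomial.exists_eq_pow_rootMultiplicity_mul_and_not_dvd
    (minpoly ℂ N) (minpoly.ne_zero (Algebra.IsIntegral.isIntegral N)) 0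
  rw [Polynomial.C_0, sub_zero] at hq hqX
  set a := (minpoly ℂ N).rootMultiplicity 0
  have hNq : N ^ a * Polynomial.aeval N q = 0 := by
    have := minpoly.aeval ℂ N
    rwa [hq, map_mul, map_pow, Polynomial.aeval_X] at this
  obtain ⟨u, w, huw⟩ : IsCoprime (Polynomial.X ^ (a + 1)) q :=
    ((Polynomial.irreducible_X.coprime_iff_not_dvd).mpr hqX).pow_left
  set e := Polynomial.aeval N (u * Polynomial.X ^ (a + 1)) with he
  have he1 : e = 1 - Polynomial.aeval N (q * w) := by
    rw [he, eq_sub_of_add_eq huw, map_sub, map_one, mul_comm w q]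
  have hNw : N ^ a * Polynomial.aeval N (q * w) = 0 := by
    rw [map_mul, ← mul_assoc, hNq, zero_mul]
  have hidem : IsIdempotentElem e := by
    have : e * Polynomial.aeval N (q * w) = 0 := by
      rw [he, pow_succ', ← mul_assoc, map_mul, map_pow, Polynomial.aeval_X, mul_assoc, hNw,
        mul_zero]
    rw [IsIdempotentElem]
    nth_rewrite 2 [he1]
    rw [mul_sub, this, mul_one, sub_zero]
  have he0 : e = 0 := by
    refine LinearMap.IsIdempotentElem.eq_zero_of_trace_eq_zero hidem ?_
    rw [he, pow_succ, ← mul_assoc]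
    exact htr _
  refine ⟨a, ?_⟩
  rw [he0, eq_comm, sub_eq_zero] at he1
  rw [← mul_one (N ^ a), he1, hNw]

lemma exists_pow_commutator_eq_zero {V : Type*} [AddCommGroup V] [Module ℂ V]
    {W : Submodule ℂ V} [FiniteDimensional ℂ W] {A B : Module.End ℂ V}
    (hA : ∀ v ∈ W, A v ∈ W) (hB : ∀ v ∈ W, B v ∈ W) (h : Commute (A * B - B * A) B) :
    ∃ p : ℕ, ∀ v ∈ W, ((A * B - B * A) ^ p) v = 0 := by
  have hN : ∀ v ∈ W, (A * B - B * A) v ∈ W := fun v hv =>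
    W.sub_mem (hA _ (hB v hv)) (hB _ (hA v hv))
  have hres : A.restrict hA * B.restrict hB - B.restrict hB * A.restrict hA =
      (A * B - B * A).restrict hN := rfl
  have hcomm : Commute (A.restrict hA * B.restrict hB - B.restrict hB * A.restrict hA)
      (B.restrict hB) := by
    refine LinearMap.ext fun v => Subtype.ext ?_
    exact LinearMap.congr_fun h.eq v
  obtain ⟨p, hp⟩ := isNilpotent_commutator_of_commute hcomm
  refine ⟨p, fun v hv => ?_⟩
  rw [hres, Module.End.pow_restrict] at hp
  exact congrArg Subtype.val (LinearMap.congr_fun hp ⟨v, hv⟩)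

namespace TRep

variable {P : PreT} {C : Cartan P} {T : Torus P C} {X : Toroidal P C T} {M : TRep X}

open PreT Cartan Toroidal

section

variable (hfin : M.FinWt) (hK0 : ∀ i, M.ρ (X.K 0 i) = 0) {Λ : C.Wt} (hΛ0 : Λ.1 ≠ 0)
  (hact : ∀ h : ↥C.h0, ∀ v ∈ M.Vplus, M.ρ (X.E 0 (h : P.g)) v = Λ.1 h • v)
  {h₀ : ↥C.h0} (hh₀ : Λ.1 h₀ ≠ 0)

include hfin hK0 hΛ0 hact hh₀ in
lemma K_not_injective (hW : M.VplusGr Λ 0 ≠ ⊥) {s : Fin P.n → ℤ} (hs : P.inΓ s) (i : Fin P.n) :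
    ¬ ∀ v, M.ρ (X.K s i) v = 0 → v = 0 := by
  intro hinj
  set W := M.VplusGr Λ 0 with hWdef
  obtain ⟨w, hw, hw0⟩ := Submodule.exists_mem_ne_zero_of_ne_bot hW
  by_cases hs0 : s = 0
  · exact hw0 (hinj w (by rw [hs0, hK0, LinearMap.zero_apply]))
  obtain ⟨l, hl⟩ : ∃ l, s l ≠ 0 := Function.ne_iff.mp hs0
  have h2s : P.inΓ ((2 : ℤ) • s) := inΓ_zsmul 2 hs
  have hns := inΓ_neg hs
  set F := M.ρ (X.K s i) with hF
  set D := M.ρ (X.Dop (-s) l) with hD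
  set G := M.ρ (X.K ((2 : ℤ) • s) i) with hG
  have hDF : Commute D F := by
    refine M.commute_of_lie_eq_zero ?_
    rw [X.br_DK _ _ hns hs, neg_add_cancel]
    simp only [map_add, map_smul, map_sum, hK0, smul_zero, Finset.sum_const_zero, add_zero]
  have hDG : D * G - G * D = (2 * s l : ℂ) • F := by
    rw [← M.ρ_lie, X.br_DK _ _ hns h2s]
    have h1 : -s + (2 : ℤ) • s = s := by rw [two_smul]; abel
    have h2 : ∑ p, ((-s) p : ℂ) • X.K s p = 0 := by
      have := X.K_dA s hs
      simp only [Pi.neg_apply, Int.cast_neg, neg_smul, Finset.sum_neg_distrib, this, neg_zero]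
    rw [h1, h2, smul_zero, add_zero, map_smul]
    simp [hF]
  have hFG : Commute F G := M.commute_of_lie_eq_zero (by rw [X.br_KK, map_zero])
  have hFW : ∀ v ∈ W, (F ^ 2) v ∈ M.VplusGr Λ (0 + (2 : ℤ) • s) := by
    intro v hv
    rw [pow_two, Module.End.mul_apply, two_smul, ← add_assoc]
    exact K_VplusGr hs i (K_VplusGr hs i hv)
  have hGW : ∀ v ∈ W, G v ∈ M.VplusGr Λ (0 + (2 : ℤ) • s) := fun v hv => K_VplusGr h2s i hv
  have hAW : ∀ v ∈ W, (F * D) v ∈ W := by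
    intro v hv
    have := K_VplusGr hs i (Dop_VplusGr hns l hv)
    rwa [neg_add_cancel_right] at this
  have hfd : FiniteDimensional ℂ W := VplusGr_finite hfin hK0 hact 0
  have hfd' := VplusGr_finite hfin hK0 hact (0 + (2 : ℤ) • s)
  let e : W ≃ₗ[ℂ] M.VplusGr Λ (0 + (2 : ℤ) • s) :=
    LinearEquiv.ofInjectiveOfFinrankEq ((F ^ 2).restrict hFW) (by
      rw [injective_iff_map_eq_zero]
      intro v hv
      refine Subtype.ext (hinj _ (hinj _ ?_))
      have := congrArg Subtype.val hv
      simpa [pow_two] using this)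
      (finrank_VplusGr hfin hK0 hΛ0 hact hh₀ h2s 0).symm
  have he : ∀ v : W, (e v : M.V) = F (F v) := fun v => by
    have : e v = (F ^ 2).restrict hFW v := rfl
    rw [this, LinearMap.coe_restrict_apply, pow_two, Module.End.mul_apply]
  let A : Module.End ℂ W := (F * D).restrict hAW
  let B : Module.End ℂ W := e.symm.toLinearMap ∘ₗ G.restrict hGW
  have hB : ∀ v : W, F (F (B v)) = G v := fun v => by
    rw [← he]
    exact congrArg Subtype.val (e.apply_symm_apply (G.restrict hGW v))
  have hAB : A * B - B * A = (2 * s l : ℂ) • (1 : Module.End ℂ W) := by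
    refine LinearMap.ext fun v => e.injective (Subtype.ext ?_)
    have hDF' : ∀ v, D (F v) = F (D v) := fun v => LinearMap.congr_fun hDF.eq v
    have hFG' : ∀ v, F (G v) = G (F v) := fun v => LinearMap.congr_fun hFG.eq v
    have hDG' : ∀ v, D (G v) = G (D v) + (2 * s l : ℂ) • F v := fun v => by
      have := LinearMap.congr_fun hDG v
      rw [LinearMap.sub_apply, sub_eq_iff_eq_add'] at this
      exact this
    rw [he, he]
    have hA : ∀ v : W, (A v : M.V) = F (D v) := fun v => rfl
    rw [LinearMap.sub_apply, Submodule.coe_sub, Module.End.mul_apply, Module.End.mul_apply,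
      map_sub, map_sub, hB, hA, hA, ← hDF', ← hDF', hB, hDG', ← hFG']
    simp
  have hnil := isNilpotent_commutator_of_commute (A := A) (B := B) (by
    rw [hAB]; exact (Commute.one_left B).smul_left _)
  obtain ⟨p, hp⟩ := hnil
  rw [hAB, smul_pow, one_pow] at hp
  have := congrArg Subtype.val (LinearMap.congr_fun hp ⟨w, hw⟩)
  have hl' : (2 * s l : ℂ) ≠ 0 := mul_ne_zero two_ne_zero (by exact_mod_cast hl)
  exact hw0 ((smul_eq_zero.mp this).resolve_left (pow_ne_zero p hl'))

end

/-- Subspaces of the highest weight space stable under all `h₀ ⊗ t^r` and `t^r Kᵢ`. -/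
def HKStable (M : TRep X) (h₀ : ↥C.h0) (U : Submodule ℂ M.V) : Prop :=
  U ≤ M.Vplus ∧ ∀ r, P.inΓ r → ∀ v ∈ U,
    M.ρ (X.E r (h₀ : P.g)) v ∈ U ∧ ∀ i, M.ρ (X.K r i) v ∈ U

/-- `U` is minimal among the `HKStable` subspaces meeting the degree zero part. -/
def HKMinimal (M : TRep X) (Λ : C.Wt) (h₀ : ↥C.h0) (U : Submodule ℂ M.V) : Prop :=
  HKStable M h₀ U ∧ U ⊓ M.VplusGr Λ 0 ≠ ⊥ ∧
    ∀ U' ≤ U, HKStable M h₀ U' → U' ⊓ M.VplusGr Λ 0 ≠ ⊥ → U ⊓ M.VplusGr Λ 0 ≤ U'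

lemma exists_HKMinimal (hfin : M.FinWt) (hK0 : ∀ i, M.ρ (X.K 0 i) = 0) {Λ : C.Wt}
    (hact : ∀ h : ↥C.h0, ∀ v ∈ M.Vplus, M.ρ (X.E 0 (h : P.g)) v = Λ.1 h • v)
    (h₀ : ↥C.h0) (hW : M.VplusGr Λ 0 ≠ ⊥) : ∃ U, HKMinimal M Λ h₀ U := by
  have hfd := VplusGr_finite hfin hK0 hact 0
  let S : Set (Submodule ℂ M.V) := {U | HKStable M h₀ U ∧ U ⊓ M.VplusGr Λ 0 ≠ ⊥}
  have hS : S.Nonempty := ⟨M.Vplus, ⟨le_rfl, fun r hr v hv =>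
    ⟨tauZ_Vplus (X.E_h0_mem_tauZ hr h₀.2) hv, fun i => tauZ_Vplus (X.K_mem_tauZ hr i) hv⟩⟩, by
      rwa [inf_eq_right.mpr fun v hv => hv.1]⟩
  obtain ⟨U, hU, hmin⟩ := exists_minimalFor_of_wellFoundedLT (· ∈ S)
    (fun U => Module.finrank ℂ ↥(U ⊓ M.VplusGr Λ 0)) hS
  refine ⟨U, hU.1, hU.2, fun U' hle hst hne => ?_⟩
  have hfd' : FiniteDimensional ℂ ↥(U ⊓ M.VplusGr Λ 0) :=
    Submodule.finiteDimensional_of_le inf_le_right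
  have h1 : U' ⊓ M.VplusGr Λ 0 ≤ U ⊓ M.VplusGr Λ 0 := inf_le_inf_right _ hle
  have h2 := hmin ⟨hst, hne⟩ (Submodule.finrank_mono h1)
  rw [← Submodule.eq_of_le_of_finrank_le h1 h2]
  exact inf_le_left

section

variable (hfin : M.FinWt) (hK0 : ∀ i, M.ρ (X.K 0 i) = 0) {Λ : C.Wt} (hΛ0 : Λ.1 ≠ 0)
  (hact : ∀ h : ↥C.h0, ∀ v ∈ M.Vplus, M.ρ (X.E 0 (h : P.g)) v = Λ.1 h • v)
  {h₀ : ↥C.h0} (hh₀ : Λ.1 h₀ ≠ 0)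
include hfin hK0 hΛ0 hact hh₀

/-- A locally nilpotent homogeneous operator commuting with all `h₀ ⊗ t^r` and `t^r Kᵢ` kills the
degree zero part of a minimal subspace. -/
lemma HKMinimal.eq_zero_of_nilpotent {U : Submodule ℂ M.V} (hU : HKMinimal M Λ h₀ U)
    {G : Module.End ℂ M.V} {d : Fin P.n → ℤ} (hd : P.inΓ d)
    (hGd : ∀ a, ∀ v ∈ M.VplusGr Λ a, G v ∈ M.VplusGr Λ (a + d)) (hGU : ∀ v ∈ U, G v ∈ U)
    (hGh : ∀ r, P.inΓ r → Commute G (M.ρ (X.E r (h₀ : P.g))))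
    (hGK : ∀ r, P.inΓ r → ∀ i, Commute G (M.ρ (X.K r i)))
    (hnil : ∀ v ∈ M.VplusGr Λ 0, ∃ p : ℕ, (G ^ p) v = 0)
    {v : M.V} (hv : v ∈ U) (hv' : v ∈ M.VplusGr Λ 0) : G v = 0 := by
  have hker : ∀ F : Module.End ℂ M.V, Commute G F → ∀ v, G v = 0 → G (F v) = 0 := by
    intro F hF v hv
    rw [← Module.End.mul_apply, hF.eq, Module.End.mul_apply, hv, map_zero]
  have hst : HKStable M h₀ (U ⊓ LinearMap.ker G) := by
    refine ⟨inf_le_left.trans hU.1.1, fun r hr v hv => ⟨⟨(hU.1.2 r hr v hv.1).1, ?_⟩,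
      fun i => ⟨(hU.1.2 r hr v hv.1).2 i, ?_⟩⟩⟩
    · exact hker _ (hGh r hr) v hv.2
    · exact hker _ (hGK r hr i) v hv.2
  suffices h : U ⊓ LinearMap.ker G ⊓ M.VplusGr Λ 0 ≠ ⊥ from
    (hU.2.2 _ inf_le_left hst h ⟨hv, hv'⟩).2
  obtain ⟨u, hu, hu0⟩ := Submodule.exists_mem_ne_zero_of_ne_bot hU.2.1
  classical
  have hex := hnil u hu.2
  obtain ⟨q, hq⟩ : ∃ q, Nat.find hex = q + 1 := by
    refine Nat.exists_eq_succ_of_ne_zero fun h => hu0 ?_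
    have := Nat.find_spec hex
    rwa [h, pow_zero, Module.End.one_apply] at this
  have hq1 : (G ^ q) u ≠ 0 := Nat.find_min hex (by omega)
  have hq2 : G ((G ^ q) u) = 0 := by
    rw [← Module.End.mul_apply, ← pow_succ', ← hq]
    exact Nat.find_spec hex
  have hmem : ∀ k : ℕ, (G ^ k) u ∈ U ∧ (G ^ k) u ∈ M.VplusGr Λ (0 + k • d) := by
    intro k
    induction k with
    | zero => simpa using hu
    | succ k ih =>
      rw [pow_succ', Module.End.mul_apply, succ_nsmul, ← add_assoc]
      exact ⟨hGU _ ih.1, hGd _ _ ih.2⟩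
  have hr : P.inΓ (-(q • d)) := inΓ_neg (inΓ_nsmul q hd)
  refine (Submodule.ne_bot_iff _).mpr ⟨M.ρ (X.E (-(q • d)) (h₀ : P.g)) ((G ^ q) u),
    ⟨⟨(hU.1.2 _ hr _ (hmem q).1).1, hker _ (hGh _ hr) _ hq2⟩, ?_⟩,
    fun h => hq1 (E_injective hfin hK0 hΛ0 hact hh₀ hr (hmem q).2 h)⟩
  have := E_VplusGr hr h₀.2 (hmem q).2
  rwa [add_neg_cancel_right] at this

/-- The center acts trivially. -/
lemma K_eq_zero (hirr : M.Irr) (hW : M.VplusGr Λ 0 ≠ ⊥) : M.Ztrivial := by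
  obtain ⟨U, hU⟩ := exists_HKMinimal hfin hK0 hact h₀ hW
  have hkill : ∀ s, P.inΓ s → ∀ i, ∀ v ∈ U, v ∈ M.VplusGr Λ 0 → M.ρ (X.K s i) v = 0 := by
    intro s hs i v hv hv'
    refine hU.eq_zero_of_nilpotent hfin hK0 hΛ0 hact hh₀ (G := M.ρ (X.K s i)) hs
      (fun a v hv => K_VplusGr hs i hv)
      (fun v hv => (hU.1.2 s hs v hv).2 i) (fun r hr => ?_) (fun r hr j => ?_)
      (fun v _ => (K_injective_or_nilpotent hirr hs i).resolve_left
        (K_not_injective hfin hK0 hΛ0 hact hh₀ hW hs i) v) hv hv'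
    · refine M.commute_of_lie_eq_zero ?_
      rw [← lie_skew, X.br_EK _ _ (h0_mem_wtg hr h₀.2).1, neg_zero, map_zero]
    · exact M.commute_of_lie_eq_zero (by rw [X.br_KK, map_zero])
  let Y : Submodule ℂ M.V := ⨅ r : {r // P.inΓ r}, ⨅ i, LinearMap.ker (M.ρ (X.K r i))
  have hmem : ∀ v, v ∈ Y ↔ ∀ r, P.inΓ r → ∀ i, M.ρ (X.K r i) v = 0 := by
    intro v
    simp only [Y, Submodule.mem_iInf, LinearMap.mem_ker, Subtype.forall]
  have hst : ∀ t : X.τ, ∀ v ∈ Y, M.ρ t v ∈ Y := by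
    intro t v hv
    refine stable_of_generators (U := Y) (Y := Y) (fun k x hx v hv => ?_)
      (fun r hr i v hv => ?_) (fun r hr i v hv => ?_) t hv
    · rw [hmem] at *
      intro r hr i
      rw [M.ρ_swap, ← lie_skew, X.br_EK k x hx, hv r hr i]
      simp
    · rw [(hmem v).mp hv r hr i]
      exact Y.zero_mem
    · rw [hmem] at *
      intro s hs j
      rw [M.ρ_swap, hv s hs j, ← lie_skew, X.br_DK r s hr hs]
      simp only [map_neg, map_zero, map_add, map_smul, map_sum, LinearMap.neg_apply,
        LinearMap.add_apply, LinearMap.smul_apply, LinearMap.sum_apply, hv _ (inΓ_add hr hs),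
        smul_zero, Finset.sum_const_zero, add_zero, neg_zero]
  obtain ⟨u, hu, hu0⟩ := Submodule.exists_mem_ne_zero_of_ne_bot hU.2.1
  rcases hirr.2 Y hst with h | h
  · refine absurd ?_ hu0
    have : u ∈ Y := (hmem u).mpr fun r hr i => hkill r hr i u hu.1 hu.2
    rw [h] at this
    exact this
  · intro r hr i
    refine LinearMap.ext fun v => ?_
    exact (hmem v).mp (h ▸ Submodule.mem_top) r hr i

end

section

variable (hZ : M.Ztrivial)
include hZ

lemma ρ_br_h_E {r k : Fin P.n → ℤ} (hr : P.inΓ r) {h x : P.g} (hh : h ∈ C.h0)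
    (hx : x ∈ C.wtg k 0) : M.ρ ⁅X.E r h, X.E k x⁆ = 0 := by
  have hx0 : ⁅h, x⁆ = 0 := by
    have := mem_wtfull.mp hx.2 ⟨h, hh⟩
    simpa using this
  rw [X.br_EE _ _ _ _ (h0_mem_wtg hr hh).1 hx.1, hx0, map_zero, zero_add, map_smul, map_sum]
  have : ∀ i, M.ρ (X.K (r + k) i) = 0 := fun i => by
    by_cases hk : P.inΓ (r + k)
    · exact hZ _ hk i
    · rw [X.K_not _ _ hk, map_zero]
  simp [this]

lemma commute_h {r s : Fin P.n → ℤ} (hr : P.inΓ r) (hs : P.inΓ s) {h h' : P.g} (hh : h ∈ C.h0)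
    (hh' : h' ∈ C.h0) : Commute (M.ρ (X.E r h)) (M.ρ (X.E s h')) :=
  M.commute_of_lie_eq_zero (ρ_br_h_E hZ hr hh (h0_mem_wtg hs hh'))

end

lemma ρ_D_h {p r : Fin P.n → ℤ} (hp : P.inΓ p) (hr : P.inΓ r) (i : Fin P.n) {h : P.g}
    (hh : h ∈ C.h0) : M.ρ (X.Dop p i) * M.ρ (X.E r h) =
      M.ρ (X.E r h) * M.ρ (X.Dop p i) + (r i : ℂ) • M.ρ (X.E (p + r) h) := by
  rw [← sub_eq_iff_eq_add', ← M.ρ_lie, X.br_DE p hp i r h (h0_mem_wtg hr hh).1, map_smul]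

section

variable (hfin : M.FinWt) (hZ : M.Ztrivial) {Λ : C.Wt} (hΛ0 : Λ.1 ≠ 0)
  (hact : ∀ h : ↥C.h0, ∀ v ∈ M.Vplus, M.ρ (X.E 0 (h : P.g)) v = Λ.1 h • v)
  {h₀ : ↥C.h0} (hh₀ : Λ.1 h₀ ≠ 0)
include hfin hZ hΛ0 hact hh₀

/-- If `B` is a degree zero product of operators `h₀ ⊗ t^r`, then
`[(h₀ ⊗ t^{-p}) t^p d_l, B]` kills the degree zero part of a minimal subspace. -/
lemma HKMinimal.eq_zero_of_commutator {U : Submodule ℂ M.V} (hU : HKMinimal M Λ h₀ U)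
    {p : Fin P.n → ℤ} (hp : P.inΓ p) (l : Fin P.n) {B Q : Module.End ℂ M.V}
    (hB : ∀ v ∈ M.VplusGr Λ 0, B v ∈ M.VplusGr Λ 0)
    (hBh : ∀ r, P.inΓ r → Commute B (M.ρ (X.E r (h₀ : P.g))))
    (hQh : ∀ r, P.inΓ r → Commute Q (M.ρ (X.E r (h₀ : P.g))))
    (hQB : Commute Q B) (hQU : ∀ v ∈ U, Q v ∈ U)
    (hQd : ∀ a, ∀ v ∈ M.VplusGr Λ a, Q v ∈ M.VplusGr Λ (a + p))
    (hcom : M.ρ (X.Dop p l) * B - B * M.ρ (X.Dop p l) = Q)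
    {v : M.V} (hv : v ∈ U) (hv' : v ∈ M.VplusGr Λ 0) : Q v = 0 := by
  have hK0 : ∀ i, M.ρ (X.K 0 i) = 0 := fun i => hZ 0 inΓ_zero i
  have hnp : P.inΓ (-p) := inΓ_neg hp
  set H := M.ρ (X.E (-p) (h₀ : P.g)) with hH
  have hHQ : (H * M.ρ (X.Dop p l)) * B - B * (H * M.ρ (X.Dop p l)) = H * Q := by
    rw [← mul_assoc, (hBh _ hnp).eq, mul_assoc, mul_assoc, ← mul_sub, hcom]
  have hHd : ∀ a, ∀ v ∈ M.VplusGr Λ (a + p), H v ∈ M.VplusGr Λ a := by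
    intro a v hv
    have := E_VplusGr hnp h₀.2 hv
    rwa [add_neg_cancel_right] at this
  have hfd := VplusGr_finite hfin hK0 hact 0
  obtain ⟨q, hq⟩ := exists_pow_commutator_eq_zero (W := M.VplusGr Λ 0)
    (A := H * M.ρ (X.Dop p l)) (B := B)
    (fun v hv => hHd 0 _ (Dop_VplusGr hp l hv)) hB
    (by rw [hHQ]; exact (hBh _ hnp).symm.mul_left hQB)
  rw [hHQ] at hq
  have hzero : (H * Q) v = 0 := by
    refine hU.eq_zero_of_nilpotent hfin hK0 hΛ0 hact hh₀ (d := 0) inΓ_zero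
      (fun a v hv => ?_) (fun v hv => (hU.1.2 _ hnp _ (hQU v hv)).1) (fun r hr => ?_)
      (fun r hr i => ?_) (fun v hv => ⟨q, hq v hv⟩) hv hv'
    · rw [add_zero]
      exact hHd a _ (hQd a v hv)
    · exact (commute_h hZ hnp hr h₀.2 h₀.2).mul_left (hQh r hr)
    · rw [hZ r hr i]
      exact Commute.zero_right _
  exact E_injective hfin hK0 hΛ0 hact hh₀ hnp (hQd 0 v hv') hzero

lemma HKMinimal.h_mul_h {U : Submodule ℂ M.V} (hU : HKMinimal M Λ h₀ U) {v : M.V}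
    (hv : v ∈ U) (hv' : v ∈ M.VplusGr Λ 0) {q b : Fin P.n → ℤ} (hq : P.inΓ q) (hb : P.inΓ b) :
    M.ρ (X.E q (h₀ : P.g)) (M.ρ (X.E b (h₀ : P.g)) v) =
      Λ.1 h₀ • M.ρ (X.E (q + b) (h₀ : P.g)) v := by
  have hK0 : ∀ i, M.ρ (X.K 0 i) = 0 := fun i => hZ 0 inΓ_zero i
  set H : (Fin P.n → ℤ) → Module.End ℂ M.V := fun r => M.ρ (X.E r (h₀ : P.g)) with hH
  have hc : ∀ {r s}, P.inΓ r → P.inΓ s → Commute (H r) (H s) :=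
    fun hr hs => commute_h hZ hr hs h₀.2 h₀.2
  have hcv : ∀ {r s}, P.inΓ r → P.inΓ s → ∀ v, H r (H s v) = H s (H r v) :=
    fun hr hs v => LinearMap.congr_fun (hc hr hs).eq v
  have hd : ∀ {r a}, P.inΓ r → ∀ {v}, v ∈ M.VplusGr Λ a → H r v ∈ M.VplusGr Λ (a + r) :=
    fun hr _ hv => E_VplusGr hr h₀.2 hv
  have hu : ∀ {r}, P.inΓ r → ∀ {v}, v ∈ U → H r v ∈ U := fun hr _ hv => (hU.1.2 _ hr _ hv).1
  have hinj : ∀ {r a}, P.inΓ r → ∀ {v}, v ∈ M.VplusGr Λ a → H r v = 0 → v = 0 :=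
    fun hr _ hv h => E_injective hfin hK0 hΛ0 hact hh₀ hr hv h
  have h0v : ∀ {v}, v ∈ M.Vplus → H 0 v = Λ.1 h₀ • v := fun hv => hact h₀ _ hv
  have hDH : ∀ {p r}, P.inΓ p → P.inΓ r → ∀ i v, M.ρ (X.Dop p i) (H r v) =
      H r (M.ρ (X.Dop p i) v) + (r i : ℂ) • H (p + r) v := fun hp hr i v =>
    LinearMap.congr_fun (ρ_D_h hp hr i h₀.2) v
  have star : ∀ {a b}, P.inΓ a → P.inΓ b → H a (H b v) = H (a + (b + b)) (H (-b) v) := by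
    intro a b ha hb
    by_cases hb0 : b = 0
    · simp [hb0]
    obtain ⟨l, hl⟩ : ∃ l, b l ≠ 0 := Function.ne_iff.mp hb0
    have hnb := inΓ_neg hb
    have hab := inΓ_add ha (inΓ_add hb hb)
    have hl' : (b l : ℂ) ≠ 0 := by exact_mod_cast hl
    have := hU.eq_zero_of_commutator hfin hZ hΛ0 hact hh₀ (p := a + b) (inΓ_add ha hb) l
      (B := H b * H (-b))
      (Q := (b l : ℂ) • (H (a + (b + b)) * H (-b)) - (b l : ℂ) • (H a * H b))
      (fun v hv => by
        have := hd hb (hd hnb hv)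
        rwa [neg_add_cancel_right] at this)
      (fun r hr => (hc hb hr).mul_left (hc hnb hr))
      (fun r hr => (((hc hab hr).mul_left (hc hnb hr)).smul_left _).sub_left
        (((hc ha hr).mul_left (hc hb hr)).smul_left _))
      (((((hc hab hb).mul_left (hc hnb hb)).smul_left _).sub_left
        (((hc ha hb).mul_left (hc hb hb)).smul_left _)).mul_right
        ((((hc hab hnb).mul_left (hc hnb hnb)).smul_left _).sub_left
        (((hc ha hnb).mul_left (hc hb hnb)).smul_left _)))
      (fun v hv => U.sub_mem (U.smul_mem _ (hu hab (hu hnb hv)))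
        (U.smul_mem _ (hu ha (hu hb hv))))
      (fun k v hv => by
        refine Submodule.sub_mem _ (Submodule.smul_mem _ _ ?_) (Submodule.smul_mem _ _ ?_)
        · have := hd hab (hd hnb hv)
          rwa [show k + -b + (a + (b + b)) = k + (a + b) by abel] at this
        · have := hd ha (hd hb hv)
          rwa [show k + b + a = k + (a + b) by abel] at this)
      (by
        refine LinearMap.ext fun v => ?_
        simp only [LinearMap.sub_apply, Module.End.mul_apply, LinearMap.smul_apply]
        rw [hDH (inΓ_add ha hb) hb, hDH (inΓ_add ha hb) hnb, map_add, map_smul,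
          show a + b + b = a + (b + b) by abel, add_neg_cancel_right, hcv hb ha]
        simp only [Pi.neg_apply, Int.cast_neg]
        module)
      hv hv'
    rw [← smul_sub, LinearMap.smul_apply, smul_eq_zero, LinearMap.sub_apply, sub_eq_zero] at this
    exact (this.resolve_left hl').symm
  have dagger : ∀ {q b}, P.inΓ q → P.inΓ b →
      H b (H q v) = H (q + (b + b + b)) (H (-(b + b)) v) := by
    intro q b hq hb
    by_cases hb0 : b = 0
    · simp only [hb0, add_zero, neg_zero]
      exact hcv inΓ_zero hq v
    obtain ⟨l, hl⟩ : ∃ l, b l ≠ 0 := Function.ne_iff.mp hb0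
    have hnb := inΓ_neg (inΓ_add hb hb)
    have hp := inΓ_add hq (inΓ_add hb hb)
    have hqb := inΓ_add hq (inΓ_add (inΓ_add hb hb) hb)
    have hl' : (2 * b l : ℂ) ≠ 0 := mul_ne_zero two_ne_zero (by exact_mod_cast hl)
    set R := H (q + (b + b + b)) * H (-(b + b)) - H b * H q with hR
    have hRh : ∀ r, P.inΓ r → Commute R (H r) := fun r hr =>
      ((hc hqb hr).mul_left (hc hnb hr)).sub_left ((hc hb hr).mul_left (hc hq hr))
    have hRd : ∀ k, ∀ v ∈ M.VplusGr Λ k, R v ∈ M.VplusGr Λ (k + (q + b)) := by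
      intro k v hv
      refine Submodule.sub_mem _ ?_ ?_
      · have := hd hqb (hd hnb hv)
        rwa [show k + -(b + b) + (q + (b + b + b)) = k + (q + b) by abel] at this
      · have := hd hb (hd hq hv)
        rwa [add_assoc] at this
    have hRU : ∀ v ∈ U, R v ∈ U := fun v hv =>
      U.sub_mem (hu hqb (hu hnb hv)) (hu hb (hu hq hv))
    have hQh : ∀ r, P.inΓ r → Commute ((2 * b l : ℂ) • (H b * R)) (H r) := fun r hr =>
      ((hc hb hr).mul_left (hRh r hr)).smul_left _
    have := hU.eq_zero_of_commutator hfin hZ hΛ0 hact hh₀ hp l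
      (B := H b * (H b * H (-(b + b)))) (Q := (2 * b l : ℂ) • (H b * R))
      (fun v hv => by
        have := hd hb (hd hb (hd hnb hv))
        rwa [show (0 : Fin P.n → ℤ) + -(b + b) + b + b = 0 by abel] at this)
      (fun r hr => (hc hb hr).mul_left ((hc hb hr).mul_left (hc hnb hr)))
      hQh ((hQh b hb).mul_right ((hQh b hb).mul_right (hQh _ hnb)))
      (fun v hv => U.smul_mem _ (hu hb (hRU v hv)))
      (fun k v hv => Submodule.smul_mem _ _ (by
        have := hd hb (hRd k v hv)
        rwa [show k + (q + b) + b = k + (q + (b + b)) by abel] at this))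
      (by
        refine LinearMap.ext fun v => ?_
        simp only [hR, LinearMap.sub_apply, Module.End.mul_apply, LinearMap.smul_apply]
        rw [hDH hp hb, hDH hp hb, hDH hp hnb, map_add, map_add, map_add, map_smul, map_smul,
          map_smul, show q + (b + b) + b = q + (b + b + b) by abel, add_neg_cancel_right,
          hcv hqb hb, map_sub]
        simp only [Pi.neg_apply, Pi.add_apply, Int.cast_neg, Int.cast_add]
        module)
      hv hv'
    rw [LinearMap.smul_apply, smul_eq_zero] at this
    have h1 := hinj hb (hRd 0 v hv') (this.resolve_left hl')
    rw [hR, LinearMap.sub_apply, sub_eq_zero] at h1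
    exact h1.symm
  have ddagger : ∀ {q b}, P.inΓ q → P.inΓ b → H b (H q v) = H (q - b) (H (b + b) v) := by
    intro q b hq hb
    rw [dagger hq hb, star (inΓ_sub hq hb) (inΓ_add hb hb),
      show q - b + (b + b + (b + b)) = q + (b + b + b) by abel]
  have hbb := inΓ_add hb hb
  have hnb := inΓ_neg hb
  have h1 : H b (H b v) = Λ.1 h₀ • H (b + b) v := by
    rw [ddagger hb hb, sub_self, h0v (hd hbb hv').1]
  have h2 : H b (H (-b) v) = (Λ.1 h₀ * Λ.1 h₀) • v := by
    have h3 : H b (H b (H (-b) v) - (Λ.1 h₀ * Λ.1 h₀) • v) = 0 := by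
      rw [map_sub, hcv hb hnb, hcv hb hnb, h1, map_smul, hcv hnb hbb]
      have := star inΓ_zero hb
      rw [zero_add, h0v (hd hb hv').1] at this
      rw [← this, map_smul, smul_smul, sub_self]
    have h4 := hinj (a := 0) hb (Submodule.sub_mem _ (by
      have := hd hb (hd hnb hv')
      rwa [neg_add_cancel_right] at this) (Submodule.smul_mem _ _ hv')) h3
    exact sub_eq_zero.mp h4
  have h5 : ∀ {a}, P.inΓ a → H a (H (b + b) v) = Λ.1 h₀ • H (a + (b + b)) v := by
    intro a ha
    have h6 : H b (H a (H b v)) = H b (H (a + (b + b)) (H (-b) v)) := by rw [star ha hb]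
    rw [hcv hb ha, h1, hcv hb (inΓ_add ha hbb), h2, map_smul, map_smul, mul_smul] at h6
    exact smul_right_injective _ hh₀ h6
  change H q (H b v) = Λ.1 h₀ • H (q + b) v
  rw [hcv hq hb, ddagger hq hb, h5 (inΓ_sub hq hb), show q - b + (b + b) = q + b by abel]

lemma h_mul_h (hirr : M.Irr) (hW : M.VplusGr Λ 0 ≠ ⊥) {r s : Fin P.n → ℤ} (hr : P.inΓ r)
    (hs : P.inΓ s) {v : M.V} (hv : v ∈ M.Vplus) :
    M.ρ (X.E r (h₀ : P.g)) (M.ρ (X.E s (h₀ : P.g)) v) =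
      Λ.1 h₀ • M.ρ (X.E (r + s) (h₀ : P.g)) v := by
  have hK0 : ∀ i, M.ρ (X.K 0 i) = 0 := fun i => hZ 0 inΓ_zero i
  set H : (Fin P.n → ℤ) → Module.End ℂ M.V := fun r => M.ρ (X.E r (h₀ : P.g)) with hH
  obtain ⟨U, hU⟩ := exists_HKMinimal hfin hK0 hact h₀ hW
  let Y : Submodule ℂ M.V := M.Vplus ⊓ ⨅ r : {r // P.inΓ r}, ⨅ s : {s // P.inΓ s},
    LinearMap.ker (H r * H s - Λ.1 h₀ • H (r + s))
  have hmem : ∀ v, v ∈ Y ↔ v ∈ M.Vplus ∧ ∀ r, P.inΓ r → ∀ s, P.inΓ s →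
      H r (H s v) = Λ.1 h₀ • H (r + s) v := by
    intro v
    simp only [Y, Submodule.mem_inf, Submodule.mem_iInf, LinearMap.mem_ker, Subtype.forall,
      LinearMap.sub_apply, sub_eq_zero, Module.End.mul_apply, LinearMap.smul_apply]
  have hY : Y ≠ ⊥ := by
    obtain ⟨u, hu, hu0⟩ := Submodule.exists_mem_ne_zero_of_ne_bot hU.2.1
    refine (Submodule.ne_bot_iff _).mpr ⟨u, (hmem u).mpr ⟨hu.2.1, fun r hr s hs => ?_⟩, hu0⟩
    exact hU.h_mul_h hfin hZ hΛ0 hact hh₀ hu.1 hu.2 hr hs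
  refine ((hmem v).mp (eq_Vplus_of_stable hirr hact inf_le_left hY ?_ hv)).2 r hr s hs
  intro t ht v hv
  rw [hmem] at hv ⊢
  refine ⟨tauZ_Vplus ht hv.1, fun r hr s hs => ?_⟩
  rcases ht with ⟨k, x, hx, rfl⟩ | ⟨p, i, hp, rfl | rfl⟩
  · have hsw : ∀ r, P.inΓ r → ∀ v, H r (M.ρ (X.E k x) v) = M.ρ (X.E k x) (H r v) := by
      intro r hr v
      rw [hH, M.ρ_swap, ρ_br_h_E hZ hr h₀.2 hx, LinearMap.zero_apply, add_zero]
    rw [hsw s hs, hsw r hr, hv.2 r hr s hs, map_smul, hsw _ (inΓ_add hr hs)]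
  · rw [hZ p hp i]
    simp
  · have hDH : ∀ r, P.inΓ r → ∀ v, H r (M.ρ (X.Dop p i) v) =
        M.ρ (X.Dop p i) (H r v) - (r i : ℂ) • H (p + r) v := fun r hr v => by
      have := LinearMap.congr_fun (ρ_D_h hp hr i h₀.2) v
      rw [eq_sub_iff_add_eq]
      exact this.symm
    rw [hDH s hs, map_sub, hDH r hr, map_smul, hv.2 r hr s hs, hv.2 _ (inΓ_add hp hr) s hs,
      hv.2 r hr _ (inΓ_add hp hs), map_smul, hDH _ (inΓ_add hr hs),
      show p + r + s = p + (r + s) by abel, show r + (p + s) = p + (r + s) by abel]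
    simp only [Pi.add_apply, Int.cast_add]
    module

end

end TRep

section Statements

variable {P : PreT} {C : Cartan P} {T : Torus P C} {X : Toroidal P C T}

/-- Lemma 4.3. -/
theorem statement5 (M : TRep X) (hirr : M.Irr) (hhw : M.IsHW) (hfin : M.FinWt)
    (Λ : C.Wt) (hΛ : Λ ∈ M.wts) (hΛ0 : Λ.1 ≠ 0)
    (hact : ∀ h : ↥C.h0, ∀ v ∈ M.Vplus, M.ρ (X.E 0 (h : P.g)) v = Λ.1 h • v)
    (h₀ : ↥C.h0) (hh₀ : Λ.1 h₀ ≠ 0) :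
    (∀ (k r : Fin P.n → ℤ), P.inΓ r →
      Module.finrank ℂ ↥(M.VplusGr Λ (k + r)) = Module.finrank ℂ ↥(M.VplusGr Λ k)) ∧
    (∃ N : ℕ, 0 < N ∧
      (∀ r : Fin P.n → ℤ, P.inΓ r → Module.finrank ℂ ↥(M.VplusGr Λ r) = N) ∧
      (∀ r : Fin P.n → ℤ, P.inΓ r → ∀ i, ∀ v ∈ M.Vplus, (M.ρ (X.K r i) ^ N) v = 0)) ∧
    (∀ w ∈ M.Vplus, w ≠ 0 → ∀ r : Fin P.n → ℤ, P.inΓ r → r ≠ 0 → ∀ i,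
      M.ρ (X.K r i) w = 0 → ∀ v ∈ M.Vplus, ∃ p : ℕ, (M.ρ (X.K r i) ^ p) v = 0) ∧
    (∀ (r s : Fin P.n → ℤ), P.inΓ r → P.inΓ s → ∀ v ∈ M.Vplus,
      M.ρ (X.E r (h₀ : P.g)) (M.ρ (X.E s (h₀ : P.g)) v) =
        Λ.1 h₀ • M.ρ (X.E (r + s) (h₀ : P.g)) v) := by
  obtain ⟨-, -, -, -, -, -, hK0⟩ := id hhw
  have hW := TRep.VplusGr_zero_ne_bot hirr hhw hΛ hact
  have hZ := TRep.K_eq_zero hfin hK0 hΛ0 hact hh₀ hirr hW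
  have hN : 0 < Module.finrank ℂ ↥(M.VplusGr Λ 0) := by
    have := TRep.VplusGr_finite hfin hK0 hact 0
    have := Submodule.nontrivial_iff_ne_bot.mpr hW
    exact Module.finrank_pos
  refine ⟨fun k r hr => TRep.finrank_VplusGr hfin hK0 hΛ0 hact hh₀ hr k,
    ⟨_, hN, fun r hr => ?_, fun r hr i v _ => ?_⟩,
    fun w _ _ r hr _ i _ v _ => ⟨1, ?_⟩,
    fun r s hr hs v hv => TRep.h_mul_h hfin hZ hΛ0 hact hh₀ hirr hW hr hs hv⟩
  · have := TRep.finrank_VplusGr hfin hK0 hΛ0 hact hh₀ hr 0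
    rwa [zero_add] at this
  · rw [hZ r hr i, zero_pow hN.ne', LinearMap.zero_apply]
  · rw [hZ r hr i, pow_one, LinearMap.zero_apply]

end Statements
end
end

section
/- Let n ≥ 2 and let V be a level zero irreducible highest weight module for the twisted full toroidal Lie algebra τ̃ having finite-dimensional weight spaces with respect to h̃, on whose highest weight space V₊ the subalgebra 𝔥_{0̄} does not act trivially. Suppose that there exists N ∈ ℕ such that for each 1 ≤ i ≤ n, (t^{r₁}Kᵢ ⋯ t^{r_N}Kᵢ)·V₊ = 0 for all r₁,…,r_N ∈ Γ \ {0}. Then there exists a non-zero vector v₀ ∈ V₊ such that 𝒵(m)·v₀ = 0. -/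
open scoped BigOperators TensorProduct

noncomputable section

section Statements

variable {P : PreT} {C : Cartan P} {T : Torus P C} {X : Toroidal P C T}

/-- If all products of `N` members of a family `f` of endomorphisms kill an `f`-stable set `W`
containing a nonzero vector, then some nonzero vector of `W` is killed by every member of `f`. -/
theorem exists_ne_zero_forall_apply_eq_zero {R A ι : Type*} [Semiring R] [AddCommMonoid A]
    [Module R A] (f : ι → Module.End R A) (W : Set A) (hW : ∀ i, ∀ v ∈ W, f i v ∈ W)
    (hne : ∃ v ∈ W, v ≠ 0) (N : ℕ)
    (hN : ∀ s : Fin N → ι, ∀ v ∈ W, (List.ofFn fun j => f (s j)).prod v = 0) :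
    ∃ v ∈ W, v ≠ 0 ∧ ∀ i, f i v = 0 := by
  induction N with
  | zero =>
    obtain ⟨v, hv, hv0⟩ := hne
    exact absurd (by simpa using hN Fin.elim0 v hv) hv0
  | succ N ih =>
    by_cases h : ∀ s : Fin N → ι, ∀ v ∈ W, (List.ofFn fun j => f (s j)).prod v = 0
    · exact ih h
    push Not at h
    obtain ⟨s, v, hv, hs⟩ := h
    have stable : ∀ l : List ι, (l.map f).prod v ∈ W := by
      intro l
      induction l with
      | nil => simpa using hv
      | cons i l ihl => simpa using hW i _ ihl
    refine ⟨_, ?_, hs, fun i => ?_⟩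
    · simpa [List.map_ofFn, Function.comp_def] using stable (List.ofFn s)
    · simpa [List.ofFn_succ] using hN (Fin.cons i s) v hv

/-- The action of `𝒵(m)` preserves the highest weight space. -/
theorem TRep.K_apply_mem_Vplus (M : TRep X) (r : Fin P.n → ℤ) (i : Fin P.n) {v : M.V}
    (hv : v ∈ M.Vplus) : M.ρ (X.K r i) v ∈ M.Vplus := by
  simp only [TRep.Vplus, Submodule.mem_iInf, LinearMap.mem_ker] at hv ⊢
  intro t ht
  have hv' := hv t ht
  obtain ⟨α, -, k, x, hx, rfl⟩ := ht
  have h := M.ρ_lie (X.E k x) (X.K r i)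
  rw [X.br_EK k x hx.1, map_zero] at h
  simpa [hv'] using (LinearMap.congr_fun h v).symm

theorem TRep.K_apply_comm (M : TRep X) (r s : Fin P.n → ℤ) (i j : Fin P.n) (v : M.V) :
    M.ρ (X.K r i) (M.ρ (X.K s j) v) = M.ρ (X.K s j) (M.ρ (X.K r i) v) := by
  have h := M.ρ_lie (X.K r i) (X.K s j)
  rw [X.br_KK, map_zero] at h
  simpa using sub_eq_zero.mp (LinearMap.congr_fun h v).symm

/-- Lemma 4.4. -/
theorem statement6 (hn : 2 ≤ P.n) (M : TRep X) (hirr : M.Irr) (hhw : M.IsHW)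
    (hfin : M.FinWt)
    (hh0 : ∃ h : ↥C.h0, ∃ v ∈ M.Vplus, M.ρ (X.E 0 (h : P.g)) v ≠ 0)
    (N : ℕ) (hNpos : 0 < N)
    (hkill : ∀ i : Fin P.n, ∀ rs : Fin N → (Fin P.n → ℤ),
      (∀ j, P.inΓ (rs j) ∧ rs j ≠ 0) →
      ∀ v ∈ M.Vplus, (List.ofFn fun j => M.ρ (X.K (rs j) i)).prod v = 0) :
    ∃ v₀ ∈ M.Vplus, v₀ ≠ 0 ∧ ∀ r, P.inΓ r → ∀ i, M.ρ (X.K r i) v₀ = 0 := by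
  obtain ⟨v, hv0, -, -, hvP, -, hK0⟩ := hhw
  suffices h : ∀ S : Finset (Fin P.n), ∃ v ∈ M.Vplus, v ≠ 0 ∧
      ∀ i ∈ S, ∀ r, P.inΓ r → M.ρ (X.K r i) v = 0 by
    obtain ⟨v₀, hv₀, hne, hz⟩ := h Finset.univ
    exact ⟨v₀, hv₀, hne, fun r hr i => hz i (Finset.mem_univ i) r hr⟩
  intro S
  induction S using Finset.induction_on with
  | empty =>
    refine ⟨v, ?_, hv0, by simp⟩
    simpa only [TRep.Vplus, Submodule.mem_iInf, LinearMap.mem_ker] using hvP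
  | insert i S _ ih =>
    obtain ⟨u, hu, hu0, huz⟩ := ih
    obtain ⟨w, ⟨hw, hwz⟩, hw0, hwi⟩ := exists_ne_zero_forall_apply_eq_zero
      (fun r : {r : Fin P.n → ℤ // P.inΓ r ∧ r ≠ 0} => M.ρ (X.K r.1 i))
      {w | w ∈ M.Vplus ∧ ∀ j ∈ S, ∀ r, P.inΓ r → M.ρ (X.K r j) w = 0}
      (fun r w hw => ⟨M.K_apply_mem_Vplus r.1 i hw.1, fun j hj s hs => by
        rw [M.K_apply_comm, hw.2 j hj s hs, map_zero]⟩)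
      ⟨u, ⟨hu, huz⟩, hu0⟩ N
      (fun s w hw => hkill i (fun j => (s j).1) (fun j => (s j).2) w hw.1)
    refine ⟨w, hw, hw0, fun j hj r hr => ?_⟩
    rcases Finset.mem_insert.mp hj with rfl | hj
    · by_cases h0 : r = 0
      · rw [h0, hK0, LinearMap.zero_apply]
      · exact hwi ⟨r, hr, h0⟩
    · exact hwz j hj r hr

end Statements
end
end
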